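/- Let G be a finite group over a field F of characteristic p, and M a nonzero FG-module such that Ω^{-1}(M) (equivalently, the cokernel of an injective hull) is a p-permutation module. Then M ≅ Ω(Ω^{-1}(M)) ⊕ Q for some projective FG-module Q, and M is an endo-p-permutation module; in particular, the Lie module Lie(pk) (p ∤ k) is an endo-p-permutation F𝔖_{pk}-module. -/

import Mathlib

open CategoryTheory

variable {A : Type} [Ring A]

/-- `N` has no nonzero projective direct summand. -/
def noProjSummand (N : ModuleCat.{0} A) : Prop :=
  ∀ Q : Submodule A N, (∃ R : Submodule A N, IsCompl Q R) → Module.Projective A Q → Q = ⊥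

/-- `N` is (isomorphic to) the projective-free part `Ω⁰(M)` of `M`. -/
def isStableRep (M N : ModuleCat.{0} A) : Prop :=
  noProjSummand N ∧
    ∃ P : ModuleCat.{0} A, Module.Projective A P ∧ Nonempty (↥M ≃ₗ[A] (↥N × ↥P))

/-- `K` is (isomorphic to) the Heller translate `Ω(M)`: the kernel of a projective
cover of `M`. -/
def isSyzygy (M K : ModuleCat.{0} A) : Prop :=
  ∃ (P : ModuleCat.{0} A) (π : ↥P →ₗ[A] ↥M),
    Module.Projective A P ∧ Function.Surjective π ∧
    (∀ Q : Submodule A P, Q ⊔ LinearMap.ker π = ⊤ → Q = ⊤) ∧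
    Nonempty (↥K ≃ₗ[A] ↥(LinearMap.ker π))

/-- `N ≅ Ω^n(M)`, where `Ω⁰` takes the projective-free part. -/
def isOmegaPow : ℕ → ModuleCat.{0} A → ModuleCat.{0} A → Prop
  | 0, M, N => isStableRep M N
  | n + 1, M, N => ∃ K : ModuleCat.{0} A, isSyzygy M K ∧ isOmegaPow n K N

/-- `N ≅ Ω^i(M)` for `i : ℤ`; for negative `i` this is expressed by saying that `N` is
projective-free and `Ω^{-i}(N) ≅ Ω⁰(M)`. -/
def isOmegaZPow (i : ℤ) (M N : ModuleCat.{0} A) : Prop :=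
  if 0 ≤ i then isOmegaPow i.toNat M N
  else noProjSummand N ∧ ∃ M₀ : ModuleCat.{0} A, isOmegaPow 0 M M₀ ∧ isOmegaPow (-i).toNat N M₀

/-- `M` is periodic with period exactly `n`: `n` is the least positive integer with
`Ω^n(M) ≅ Ω⁰(M) ≠ 0`. -/
def hasPeriod (M : ModuleCat.{0} A) (n : ℕ) : Prop :=
  0 < n ∧ (∃ N : ModuleCat.{0} A, Nontrivial N ∧ isOmegaPow 0 M N ∧ isOmegaPow n M N) ∧
    ∀ m, 0 < m → m < n → ¬ ∃ N : ModuleCat.{0} A, isOmegaPow 0 M N ∧ isOmegaPow m M N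

/-- `M` is a `p`-permutation module: a direct summand of a permutation module. -/
def isPPermutationModule (F : Type) [Field F] (G : Type) [Group G]
    (M : Type) [AddCommGroup M] [Module (MonoidAlgebra F G) M] : Prop :=
  ∃ (X : Type) (_ : MulAction G X)
    (ι : M →ₗ[MonoidAlgebra F G] (Representation.ofMulAction F G X).asModule)
    (π : (Representation.ofMulAction F G X).asModule →ₗ[MonoidAlgebra F G] M),
    π ∘ₗ ι = LinearMap.id

/-- The Dynkin–Specht–Wever element `ω_n = (1 - d₂)(1 - d₃) ⋯ (1 - dₙ)` of `F𝔖_n`,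
where `d_i = (i, i-1, …, 1)` is the descending `i`-cycle. -/
noncomputable def dswElement (F : Type) [Field F] (n : ℕ) (hn : 0 < n) :
    MonoidAlgebra F (Equiv.Perm (Fin n)) :=
  ((List.range (n - 1)).map fun i =>
      (1 : MonoidAlgebra F (Equiv.Perm (Fin n))) -
        MonoidAlgebra.of F (Equiv.Perm (Fin n))
          (Fin.cycleRange ⟨(i + 1) % n, Nat.mod_lt _ hn⟩)⁻¹).prod

/-- The Lie module `Lie(n)`: the left ideal of `F𝔖_n` generated by the
Dynkin–Specht–Wever element. -/
noncomputable def lieModule (F : Type) [Field F] (n : ℕ) (hn : 0 < n) :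
    Submodule (MonoidAlgebra F (Equiv.Perm (Fin n))) (MonoidAlgebra F (Equiv.Perm (Fin n))) :=
  Submodule.span _ {dswElement F n hn}

/-- The representation of `𝔖_n` on `Lie(n)`. -/
noncomputable def lieRep (F : Type) [Field F] (n : ℕ) (hn : 0 < n) :
    Representation F (Equiv.Perm (Fin n)) ↥(lieModule F n hn) :=
  Representation.ofModule' (k := F) (G := Equiv.Perm (Fin n)) ↥(lieModule F n hn)

noncomputable instance tprodDualAsModuleAddCommGroup {F G V : Type} [Field F] [Group G]
    [AddCommGroup V] [Module F V] (ρ : Representation F G V) :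
    AddCommGroup (ρ.tprod ρ.dual).asModule :=
  inferInstanceAs (AddCommGroup (TensorProduct F V (V →ₗ[F] F)))

namespace LieEP

open TensorProduct

section Reps

variable {F G : Type} [Field F] [Group G]
variable {V W U V₁ V₂ V₃ : Type} [AddCommGroup V] [Module F V] [AddCommGroup W] [Module F W]
  [AddCommGroup U] [Module F U] [AddCommGroup V₁] [Module F V₁] [AddCommGroup V₂] [Module F V₂]
  [AddCommGroup V₃] [Module F V₃]

/-- Equivariance of a linear map. -/
def Equi (ρ : Representation F G V) (σ : Representation F G W) (f : V →ₗ[F] W) : Prop :=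
  ∀ g v, f (ρ g v) = σ g (f v)

/-- A representation with a permutation basis. -/
def IsPerm (σ : Representation F G W) : Prop :=
  ∃ (X : Type) (b : Module.Basis X F W), ∀ g x, ∃ y, σ g (b x) = b y

/-- Direct summand of a representation with a permutation basis. -/
def PP (ρ : Representation F G V) : Prop :=
  ∃ (W : Type) (_ : AddCommGroup W) (_ : Module F W) (σ : Representation F G W),
    IsPerm σ ∧ ∃ (i : V →ₗ[F] W) (q : W →ₗ[F] V), Equi ρ σ i ∧ Equi σ ρ q ∧ q ∘ₗ i = LinearMap.id

theorem IsPerm.pp {σ : Representation F G W} (h : IsPerm σ) : PP σ :=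
  ⟨W, _, _, σ, h, LinearMap.id, LinearMap.id, fun _ _ => rfl, fun _ _ => rfl, rfl⟩

theorem Equi.comp {ρ : Representation F G V} {σ : Representation F G W} {τ : Representation F G U}
    {f : W →ₗ[F] U} {g : V →ₗ[F] W} (hf : Equi σ τ f) (hg : Equi ρ σ g) : Equi ρ τ (f ∘ₗ g) := by
  intro a v; simp [hg a v, hf a]

theorem PP.retract {ρ : Representation F G V} {σ : Representation F G W} (h : PP σ)
    (i : V →ₗ[F] W) (q : W →ₗ[F] V) (hi : Equi ρ σ i) (hq : Equi σ ρ q)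
    (hqi : ∀ v, q (i v) = v) : PP ρ := by
  obtain ⟨W', _, _, σ', hp, i', q', hi', hq', h'⟩ := h
  refine ⟨W', _, _, σ', hp, i' ∘ₗ i, q ∘ₗ q', hi'.comp hi, hq.comp hq', ?_⟩
  ext v
  have := LinearMap.congr_fun h' (i v)
  simp only [LinearMap.comp_apply, LinearMap.id_apply] at this ⊢
  rw [this, hqi]

theorem Equi.tmap {ρ : Representation F G V} {σ : Representation F G W}
    {ρ' : Representation F G V₁} {σ' : Representation F G V₂} {f : V →ₗ[F] W} {f' : V₁ →ₗ[F] V₂}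
    (h : Equi ρ σ f) (h' : Equi ρ' σ' f') :
    Equi (ρ.tprod ρ') (σ.tprod σ') (TensorProduct.map f f') := by
  intro g v
  induction v with
  | zero => simp
  | add x y hx hy => simp only [map_add, hx, hy]
  | tmul x y => simp [Representation.tprod_apply, h g, h' g]

theorem IsPerm.tprod {σ : Representation F G W} {σ' : Representation F G U}
    (h : IsPerm σ) (h' : IsPerm σ') : IsPerm (σ.tprod σ') := by
  obtain ⟨X, b, hb⟩ := h
  obtain ⟨X', b', hb'⟩ := h'
  refine ⟨X × X', b.tensorProduct b', ?_⟩
  rintro g ⟨x, x'⟩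
  obtain ⟨y, hy⟩ := hb g x
  obtain ⟨y', hy'⟩ := hb' g x'
  exact ⟨(y, y'), by simp [Representation.tprod_apply, hy, hy']⟩

theorem PP.tprod {σ : Representation F G W} {σ' : Representation F G U}
    (h : PP σ) (h' : PP σ') : PP (σ.tprod σ') := by
  obtain ⟨W₁, _, _, τ, hp, i, q, hi, hq, e⟩ := h
  obtain ⟨W₂, _, _, τ', hp', i', q', hi', hq', e'⟩ := h'
  refine ⟨_, _, _, τ.tprod τ', hp.tprod hp', _, _, hi.tmap hi', hq.tmap hq', ?_⟩
  rw [← TensorProduct.map_comp, e, e', TensorProduct.map_id]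

/-- Sum version of retraction. -/
theorem PP.retract₂ {ρ : Representation F G V} {σ₁ : Representation F G V₁}
    {σ₂ : Representation F G V₂} (h₁ : PP σ₁) (h₂ : PP σ₂)
    (i₁ : V →ₗ[F] V₁) (i₂ : V →ₗ[F] V₂) (q₁ : V₁ →ₗ[F] V) (q₂ : V₂ →ₗ[F] V)
    (hi₁ : Equi ρ σ₁ i₁) (hi₂ : Equi ρ σ₂ i₂) (hq₁ : Equi σ₁ ρ q₁) (hq₂ : Equi σ₂ ρ q₂)
    (hqi : ∀ v, q₁ (i₁ v) + q₂ (i₂ v) = v) : PP ρ := by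
  obtain ⟨W₁, _, _, τ, ⟨X, b, hb⟩, i, q, hi, hq, e⟩ := h₁
  obtain ⟨W₂, _, _, τ', ⟨X', b', hb'⟩, i', q', hi', hq', e'⟩ := h₂
  have P : PP (τ.prod τ') := by
    refine IsPerm.pp ⟨X ⊕ X', b.prod b', ?_⟩
    rintro g (x | x)
    · obtain ⟨y, hy⟩ := hb g x
      exact ⟨Sum.inl y, by simp [Representation.prod, hy]⟩
    · obtain ⟨y, hy⟩ := hb' g x
      exact ⟨Sum.inr y, by simp [Representation.prod, hy]⟩
  refine P.retract ((i ∘ₗ i₁).prod (i' ∘ₗ i₂)) ((q₁ ∘ₗ q).coprod (q₂ ∘ₗ q')) ?_ ?_ ?_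
  · intro g v
    simp [Representation.prod, hi₁ g, hi g, hi₂ g, hi' g]
  · rintro g ⟨v, w⟩
    simp [Representation.prod, hq g, hq' g, hq₁ g, hq₂ g]
  · intro v
    have e1 := LinearMap.congr_fun e (i₁ v)
    have e2 := LinearMap.congr_fun e' (i₂ v)
    simp only [LinearMap.comp_apply, LinearMap.id_apply] at e1 e2
    simp [e1, e2, hqi]

theorem PP.comp_hom {H : Type} [Group H] (f : H →* G) {ρ : Representation F G V} (h : PP ρ) :
    PP (ρ.comp f : Representation F H V) := by
  obtain ⟨W, _, _, σ, ⟨X, b, hb⟩, i, q, hi, hq, e⟩ := h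
  exact ⟨W, _, _, σ.comp f, ⟨X, b, fun g x => hb (f g) x⟩, i, q, fun g => hi (f g),
    fun g => hq (f g), e⟩

theorem Equi.dual {ρ : Representation F G V} {σ : Representation F G W} {f : V →ₗ[F] W}
    (h : Equi ρ σ f) : Equi σ.dual ρ.dual (Module.Dual.transpose (R := F) f) := by
  intro g v
  ext x
  simp [Representation.dual_apply, Module.Dual.transpose_apply, h g⁻¹ x]

/-- Induced action on the index set of a permutation basis. -/
@[reducible] noncomputable def permAct {σ : Representation F G W} {X : Type} (b : Module.Basis X F W)
    (hb : ∀ g x, ∃ y, σ g (b x) = b y) : MulAction G X where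
  smul g x := (hb g x).choose
  one_smul x := b.injective <| by
    exact (hb 1 x).choose_spec.symm.trans (by simp)
  mul_smul g h x := b.injective <| by
    have h1 := (hb (g * h) x).choose_spec
    have h2 := (hb h x).choose_spec
    have h3 := (hb g (hb h x).choose).choose_spec
    exact h1.symm.trans ((by simp : σ (g * h) (b x) = σ g (σ h (b x))).trans
      ((congrArg (σ g) h2).trans h3))

theorem permAct_spec {σ : Representation F G W} {X : Type} (b : Module.Basis X F W)
    (hb : ∀ g x, ∃ y, σ g (b x) = b y) (g : G) (x : X) :
    σ g (b x) = b ((permAct b hb).toSMul.smul g x) := (hb g x).choose_spec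

/-- Functions on subsets of the group. -/
def setRep (F G U : Type) [Field F] [Group G] [AddCommGroup U] [Module F U] :
    Representation F G (Set G → U) where
  toFun g :=
    { toFun := fun h S => h {s | g * s ∈ S}
      map_add' := fun _ _ => rfl
      map_smul' := fun _ _ => rfl }
  map_one' := by ext; simp
  map_mul' a b := by
    refine LinearMap.ext fun h => funext fun S => ?_
    simp [mul_assoc]

theorem setRep_apply (g : G) (h : Set G → U) (S : Set G) :
    setRep F G U g h S = h {s | g * s ∈ S} := rfl

theorem setRep_isPerm [Finite G] : IsPerm (setRep F G U) := by
  classical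
  let _ := Fintype.ofFinite (Set G)
  refine ⟨_, Pi.basis (fun _ : Set G => Module.Basis.ofVectorSpace F U), ?_⟩
  rintro g ⟨S, x⟩
  refine ⟨⟨{s | g⁻¹ * s ∈ S}, x⟩, ?_⟩
  funext T
  have : {s | g * s ∈ T} = S ↔ T = {s | g⁻¹ * s ∈ S} := by
    constructor
    · rintro rfl; ext; simp
    · rintro rfl; ext; simp
  rw [setRep_apply, Pi.basis_apply, Pi.basis_apply]
  by_cases h : T = {s | g⁻¹ * s ∈ S}
  · subst h
    have := this.2 rfl
    simp only [Set.mem_ofPred_eq] at this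
    simp [this]
  · rw [Pi.single_eq_of_ne h, Pi.single_eq_of_ne (fun h' => h (this.1 h'))]

theorem IsPerm.dual [Finite G] {σ : Representation F G W} (h : IsPerm σ) : PP σ.dual := by
  classical
  obtain ⟨X, b, hb⟩ := h
  let _ := permAct b hb
  have hs : ∀ (g : G) (x : X), σ g (b x) = b (g • x) := permAct_spec b hb
  refine (setRep_isPerm (F := F) (G := G) (U := X → F)).pp.retract
    (i := { toFun := fun f S x => if h : ∃ g : G, S = {s | s • x = g • x}
              then f (b (h.choose • x)) else 0
            map_add' := ?_
            map_smul' := ?_ })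
    (q := { toFun := fun h => b.constr F fun x => h {s | s • (Quotient.out
              (Quotient.mk (MulAction.orbitRel G X) x)) = x}
              (Quotient.out (Quotient.mk (MulAction.orbitRel G X) x))
            map_add' := ?_
            map_smul' := ?_ }) ?_ ?_ ?_
  · intro f f'; ext S x; simp only [Pi.add_apply]; split_ifs <;> simp
  · intro c f; ext S x; simp only [Pi.smul_apply]; split_ifs <;> simp
  · intro f f'; apply b.ext; intro x; simp
  · intro c f; apply b.ext; intro x; simp
  · intro g f
    funext S x
    rw [setRep_apply]
    simp only [LinearMap.coe_mk, AddHom.coe_mk]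
    by_cases hS : ∃ k : G, S = {s | s • x = k • x}
    · obtain ⟨k, rfl⟩ := hS
      have h1 : ∃ k' : G, {s : G | s • x = k • x} = {s | s • x = k' • x} := ⟨k, rfl⟩
      have h2 : ∃ k' : G, {s : G | g * s ∈ {s : G | s • x = k • x}} = {s | s • x = k' • x} := by
        refine ⟨g⁻¹ * k, ?_⟩
        ext s
        simp only [Set.mem_ofPred_eq, mul_smul, eq_inv_smul_iff]
      have e1 : h1.choose • x = k • x := by
        have : h1.choose ∈ {s : G | s • x = h1.choose • x} := rfl
        rw [← h1.choose_spec] at this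
        exact this
      have e2 : g • h2.choose • x = k • x := by
        have : h2.choose ∈ {s : G | s • x = h2.choose • x} := rfl
        rw [← h2.choose_spec] at this
        simpa [mul_smul] using this
      rw [dif_pos h1, dif_pos h2, e1, (eq_inv_smul_iff.2 e2 : h2.choose • x = g⁻¹ • k • x)]
      simp [Representation.dual_apply, Module.Dual.transpose_apply, hs]
    · rw [dif_neg hS, dif_neg]
      rintro ⟨k, hk⟩
      apply hS
      refine ⟨g * k, ?_⟩
      ext s
      have := Set.ext_iff.1 hk (g⁻¹ * s)
      simp only [Set.mem_ofPred_eq, mul_inv_cancel_left, mul_smul, inv_smul_eq_iff] at this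
      simpa [mul_smul] using this
  · intro g h
    apply b.ext
    intro x
    have hq : (Quotient.mk (MulAction.orbitRel G X) (g⁻¹ • x)) =
      (Quotient.mk (MulAction.orbitRel G X) x) := Quotient.sound ⟨g⁻¹, rfl⟩
    simp only [LinearMap.coe_mk, AddHom.coe_mk, Representation.dual_apply,
      Module.Dual.transpose_apply, LinearMap.comp_apply, hs, Module.Basis.constr_basis, hq]
    rw [setRep_apply]
    congr 1
    simp only [Set.mem_ofPred_eq, mul_smul, eq_inv_smul_iff]
  · intro f
    apply b.ext
    intro x
    simp only [LinearMap.coe_mk, AddHom.coe_mk, Module.Basis.constr_basis]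
    generalize hr : Quotient.out (Quotient.mk (MulAction.orbitRel G X) x) = r
    have : (MulAction.orbitRel G X) r x := by
      rw [← hr]; exact Quotient.mk_out (s := MulAction.orbitRel G X) x
    obtain ⟨k, hk⟩ := (MulAction.orbitRel G X).symm this
    have h1 : ∃ g : G, {s : G | s • r = x} = {s : G | s • r = g • r} := ⟨k, by simp only at hk; rw [hk]⟩
    rw [dif_pos h1]
    have : k ∈ {s : G | s • r = h1.choose • r} := by
      rw [← h1.choose_spec]; exact hk
    rw [← show k • r = h1.choose • r from this, show k • r = x from hk]

theorem PP.dual [Finite G] {ρ : Representation F G V} (h : PP ρ) : PP ρ.dual := by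
  obtain ⟨W, _, _, σ, hp, i, q, hi, hq, e⟩ := h
  refine hp.dual.retract _ _ hq.dual hi.dual ?_
  intro f
  ext v
  have e1 := LinearMap.congr_fun e v
  simp only [LinearMap.comp_apply, LinearMap.id_apply] at e1
  simp [Module.Dual.transpose_apply, e1]

/-- Endo-p-permutation. -/
def EP (ρ : Representation F G V) : Prop := PP (ρ.tprod ρ.dual)

theorem EP.retract {ρ : Representation F G V} {σ : Representation F G W} (h : EP σ)
    (i : V →ₗ[F] W) (q : W →ₗ[F] V) (hi : Equi ρ σ i) (hq : Equi σ ρ q)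
    (hqi : ∀ v, q (i v) = v) : EP ρ := by
  refine PP.retract h (TensorProduct.map i (Module.Dual.transpose (R := F) q))
    (TensorProduct.map q (Module.Dual.transpose (R := F) i)) (hi.tmap hq.dual) (hq.tmap hi.dual) ?_
  intro v
  have h1 : q ∘ₗ i = LinearMap.id := LinearMap.ext hqi
  have h2 : Module.Dual.transpose (R := F) i ∘ₗ Module.Dual.transpose (R := F) q =
      LinearMap.id := by
    ext f v; simp [Module.Dual.transpose_apply, hqi]
  rw [← LinearMap.comp_apply, ← TensorProduct.map_comp, h1, h2, TensorProduct.map_id]; rfl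

theorem EP.of_bijective {ρ : Representation F G V} {σ : Representation F G W} (h : EP σ)
    (f : V →ₗ[F] W) (hf : Function.Bijective f) (hi : Equi ρ σ f) : EP ρ := by
  let e := LinearEquiv.ofBijective f hf
  refine h.retract e.toLinearMap e.symm.toLinearMap hi ?_ (by simp)
  intro g v
  apply e.injective
  have := hi g (e.symm v)
  change e _ = σ g (e (e.symm v)) at this
  simp only [LinearEquiv.coe_coe, LinearEquiv.apply_symm_apply] at this ⊢
  rw [this]

theorem EP.of_bijective' {ρ : Representation F G V} {σ : Representation F G W} (h : EP ρ)
    (f : V →ₗ[F] W) (hf : Function.Bijective f) (hi : Equi ρ σ f) : EP σ := by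
  let e := LinearEquiv.ofBijective f hf
  refine h.of_bijective e.symm.toLinearMap e.symm.bijective ?_
  intro g v
  apply e.injective
  have := hi g (e.symm v)
  change e _ = σ g (e (e.symm v)) at this
  simp only [LinearEquiv.coe_coe, LinearEquiv.apply_symm_apply] at this ⊢
  rw [this]

theorem PP.ep [Finite G] {ρ : Representation F G V} (h : PP ρ) : EP ρ := PP.tprod h h.dual

theorem EP.tprod [FiniteDimensional F V] [FiniteDimensional F W]
    {ρ : Representation F G V} {σ : Representation F G W} (h : EP ρ) (h' : EP σ) :
    EP (ρ.tprod σ) := by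
  have P := PP.tprod h h'
  let D := TensorProduct.dualDistribEquiv F V W
  let e : ((V ⊗[F] Module.Dual F V) ⊗[F] (W ⊗[F] Module.Dual F W)) ≃ₗ[F]
      (V ⊗[F] W) ⊗[F] Module.Dual F (V ⊗[F] W) :=
    (TensorProduct.tensorTensorTensorComm F V (Module.Dual F V) W (Module.Dual F W)).trans
      (TensorProduct.congr (LinearEquiv.refl F _) D)
  have he : Equi ((ρ.tprod ρ.dual).tprod (σ.tprod σ.dual)) ((ρ.tprod σ).tprod (ρ.tprod σ).dual)
      e.toLinearMap := by
    intro g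
    suffices H : e.toLinearMap ∘ₗ ((ρ.tprod ρ.dual).tprod (σ.tprod σ.dual)) g =
      (((ρ.tprod σ).tprod (ρ.tprod σ).dual) g) ∘ₗ e.toLinearMap from LinearMap.congr_fun H
    apply TensorProduct.ext_fourfold'
    intro v f w f'
    simp only [LinearMap.comp_apply, Representation.tprod_apply, TensorProduct.map_tmul,
      LinearEquiv.coe_coe, e, LinearEquiv.trans_apply, TensorProduct.tensorTensorTensorComm_tmul,
      TensorProduct.congr_tmul, LinearEquiv.refl_apply]
    congr 1
    apply TensorProduct.ext'
    intro x y
    simp [D, Representation.dual_apply, Module.Dual.transpose_apply,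
      TensorProduct.dualDistribEquiv, TensorProduct.dualDistribEquivOfBasis,
      Representation.tprod_apply]
  refine P.retract e.symm.toLinearMap e.toLinearMap ?_ he (by simp)
  intro g v
  apply e.injective
  have := he g (e.symm v)
  simp only [LinearEquiv.coe_coe, LinearEquiv.apply_symm_apply] at this ⊢
  rw [this]

end Reps

end LieEP

namespace LieEP

open TensorProduct

section Higman

variable {F G : Type} [Field F] [Group G]
variable {V W U V₁ V₂ V₃ : Type} [AddCommGroup V] [Module F V] [AddCommGroup W] [Module F W]
  [AddCommGroup U] [Module F U] [AddCommGroup V₁] [Module F V₁] [AddCommGroup V₂] [Module F V₂]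
  [AddCommGroup V₃] [Module F V₃]

/-- Higman's criterion for projectivity. -/
def HP [Fintype G] (ρ : Representation F G V) : Prop :=
  ∃ θ : V →ₗ[F] V, ∀ v, ∑ g, ρ g (θ (ρ g⁻¹ v)) = v

/-- Sum of conjugates of a linear map. -/
def trMap [Fintype G] (ρ : Representation F G V) (σ : Representation F G W) (f : V →ₗ[F] W) :
    V →ₗ[F] W := ∑ g, σ g ∘ₗ f ∘ₗ ρ g⁻¹

theorem trMap_apply [Fintype G] (ρ : Representation F G V) (σ : Representation F G W)
    (f : V →ₗ[F] W) (v : V) : trMap ρ σ f v = ∑ g, σ g (f (ρ g⁻¹ v)) := by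
  simp [trMap, LinearMap.sum_apply]

theorem trMap_equi [Fintype G] (ρ : Representation F G V) (σ : Representation F G W)
    (f : V →ₗ[F] W) : Equi ρ σ (trMap ρ σ f) := by
  intro g v
  rw [trMap_apply, trMap_apply, map_sum]
  rw [← Equiv.sum_comp (Equiv.mulLeft g)]
  refine Finset.sum_congr rfl fun h _ => ?_
  simp [← Module.End.mul_apply, ← map_mul]

theorem HP.retract [Fintype G] {ρ : Representation F G V} {σ : Representation F G W} (h : HP σ)
    (i : V →ₗ[F] W) (q : W →ₗ[F] V) (hi : Equi ρ σ i) (hq : Equi σ ρ q)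
    (hqi : ∀ v, q (i v) = v) : HP ρ := by
  obtain ⟨θ, hθ⟩ := h
  refine ⟨q ∘ₗ θ ∘ₗ i, fun v => ?_⟩
  have := congrArg q (hθ (i v))
  rw [hqi, map_sum] at this
  refine Eq.trans ?_ this
  refine Finset.sum_congr rfl fun g _ => ?_
  simp [hi g⁻¹, hq g]

theorem HP.tprod_left [Fintype G] {ρ : Representation F G V} (h : HP ρ)
    (σ : Representation F G W) : HP (ρ.tprod σ) := by
  obtain ⟨θ, hθ⟩ := h
  refine ⟨TensorProduct.map θ LinearMap.id, fun v => ?_⟩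
  induction v with
  | zero => simp
  | add x y hx hy => simp only [map_add, Finset.sum_add_distrib, hx, hy]
  | tmul x y =>
    simp only [Representation.tprod_apply, TensorProduct.map_tmul, LinearMap.id_apply,
      Representation.self_inv_apply, ← TensorProduct.sum_tmul, hθ]

theorem HP.tprod_right [Fintype G] {ρ : Representation F G V} (h : HP ρ)
    (σ : Representation F G W) : HP (σ.tprod ρ) := by
  obtain ⟨θ, hθ⟩ := h
  refine ⟨TensorProduct.map LinearMap.id θ, fun v => ?_⟩
  induction v with
  | zero => simp
  | add x y hx hy => simp only [map_add, Finset.sum_add_distrib, hx, hy]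
  | tmul x y =>
    simp only [Representation.tprod_apply, TensorProduct.map_tmul, LinearMap.id_apply,
      Representation.self_inv_apply, ← TensorProduct.tmul_sum, hθ]

theorem HP.dual [Fintype G] {ρ : Representation F G V} (h : HP ρ) : HP ρ.dual := by
  obtain ⟨θ, hθ⟩ := h
  refine ⟨Module.Dual.transpose (R := F) θ, fun f => ?_⟩
  ext v
  have := congrArg f (hθ v)
  rw [map_sum] at this
  simpa [Representation.dual_apply, Module.Dual.transpose_apply, LinearMap.sum_apply] using this

theorem HP.prod [Fintype G] {ρ : Representation F G V} {σ : Representation F G W} (h : HP ρ)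
    (h' : HP σ) : HP (ρ.prod σ) := by
  obtain ⟨θ, hθ⟩ := h
  obtain ⟨θ', hθ'⟩ := h'
  refine ⟨LinearMap.prodMap θ θ', fun v => ?_⟩
  ext
  · simpa [Representation.prod, Prod.fst_sum] using hθ v.1
  · simpa [Representation.prod, Prod.snd_sum] using hθ' v.2

/-- The regular representation tensored with a trivial one. -/
noncomputable def regRep (F G U : Type) [Field F] [Group G] [AddCommGroup U] [Module F U] :
    Representation F G (G → U) where
  toFun g :=
    { toFun := fun h s => h (g⁻¹ * s)
      map_add' := fun _ _ => rfl
      map_smul' := fun _ _ => rfl }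
  map_one' := by ext; simp
  map_mul' a b := by
    refine LinearMap.ext fun h => funext fun S => ?_
    simp [mul_assoc]

theorem regRep_apply (g : G) (h : G → U) (s : G) : regRep F G U g h s = h (g⁻¹ * s) := rfl

theorem regRep_isPerm [Finite G] : IsPerm (regRep F G U) := by
  classical
  let _ := Fintype.ofFinite G
  refine ⟨_, Pi.basis (fun _ : G => Module.Basis.ofVectorSpace F U), ?_⟩
  rintro g ⟨s, x⟩
  refine ⟨⟨g * s, x⟩, ?_⟩
  funext t
  rw [regRep_apply, Pi.basis_apply, Pi.basis_apply]
  by_cases h : t = g * s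
  · subst h
    simp
  · rw [Pi.single_eq_of_ne h, Pi.single_eq_of_ne]
    rintro rfl
    simp at h

theorem HP.pp [Fintype G] {ρ : Representation F G V} (h : HP ρ) : PP ρ := by
  obtain ⟨θ, hθ⟩ := h
  refine (regRep_isPerm (F := F) (G := G) (U := V)).pp.retract
    (LinearMap.pi fun g => θ ∘ₗ ρ g⁻¹) (∑ g, ρ g ∘ₗ LinearMap.proj g) ?_ ?_ ?_
  · intro g v
    funext s
    simp only [regRep_apply, LinearMap.pi_apply, LinearMap.comp_apply, mul_inv_rev, inv_inv,
      map_mul, Module.End.mul_apply]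
  · intro g v
    simp only [LinearMap.sum_apply, LinearMap.comp_apply, LinearMap.proj_apply, regRep_apply,
      map_sum]
    rw [← Equiv.sum_comp (Equiv.mulLeft g)]
    refine Finset.sum_congr rfl fun h _ => ?_
    simp [← Module.End.mul_apply]
  · intro v
    simpa [LinearMap.sum_apply] using hθ v

theorem HP.lift [Fintype G] {ρ : Representation F G V} {σ : Representation F G W}
    {τ : Representation F G U} (h : HP ρ) (f : V →ₗ[F] U) (q : W →ₗ[F] U) (hf : Equi ρ τ f)
    (hq : Equi σ τ q) (hs : Function.Surjective q) :
    ∃ s : V →ₗ[F] W, Equi ρ σ s ∧ ∀ v, q (s v) = f v := by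
  obtain ⟨θ, hθ⟩ := h
  obtain ⟨s, hs⟩ := q.exists_rightInverse_of_surjective (LinearMap.range_eq_top.2 hs)
  refine ⟨trMap ρ σ (s ∘ₗ f ∘ₗ θ), trMap_equi _ _ _, fun v => ?_⟩
  have hs' : ∀ x, q (s x) = x := fun x => LinearMap.congr_fun hs x
  rw [trMap_apply, map_sum]
  conv_rhs => rw [← hθ v, map_sum]
  refine Finset.sum_congr rfl fun g _ => ?_
  simp [hq g, hs', hf g]

theorem factor {ρ : Representation F G V} {σ : Representation F G W}
    {τ : Representation F G U} (i : W →ₗ[F] U) (hi : Function.Injective i) (hie : Equi σ τ i)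
    (f : V →ₗ[F] U) (hf : Equi ρ τ f) (h : ∀ v, f v ∈ LinearMap.range i) :
    ∃ f' : V →ₗ[F] W, Equi ρ σ f' ∧ ∀ v, i (f' v) = f v := by
  let e := LinearEquiv.ofInjective i hi
  have key : ∀ v, i (e.symm (f.codRestrict (LinearMap.range i) h v)) = f v := by
    intro v
    have : e (e.symm (f.codRestrict (LinearMap.range i) h v)) = _ := e.apply_symm_apply _
    exact congrArg Subtype.val this
  refine ⟨e.symm.toLinearMap ∘ₗ f.codRestrict (LinearMap.range i) h, ?_, key⟩
  intro g v
  apply hi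
  rw [hie g]
  exact (key _).trans ((hf g v).trans (congrArg (τ g) (key v).symm))

theorem schanuel [Fintype G] {ρA : Representation F G V} {ρP : Representation F G W}
    {ρC : Representation F G U} {ρB : Representation F G V₁} {ρQ : Representation F G V₂}
    (i : V →ₗ[F] W) (q : W →ₗ[F] U) (i' : V₁ →ₗ[F] V₂) (q' : V₂ →ₗ[F] U)
    (hi : Equi ρA ρP i) (hq : Equi ρP ρC q) (hi' : Equi ρB ρQ i') (hq' : Equi ρQ ρC q')
    (ii : Function.Injective i) (ii' : Function.Injective i')
    (sq : Function.Surjective q) (sq' : Function.Surjective q')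
    (ex : Function.Exact i q) (ex' : Function.Exact i' q')
    (hP : HP ρP) (hQ : HP ρQ) (hB : PP ρB) : PP ρA := by
  obtain ⟨s, hs, hs'⟩ := hQ.lift q' q hq' hq sq
  obtain ⟨t, ht, ht'⟩ := hP.lift q q' hq hq' sq'
  obtain ⟨a, ha, ha'⟩ := factor (ρ := ρA) i' ii' hi' (t ∘ₗ i) (ht.comp hi) (fun v => by
    have := ex.apply_apply_eq_zero v
    exact (ex' _).1 (by simp [ht', this]))
  obtain ⟨b, hb, hb'⟩ := factor (ρ := ρP) i ii hi (LinearMap.id - s ∘ₗ t) (fun g v => by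
    simp [ht g, hs g]) (fun v => (ex _).1 (by simp [hs', ht']))
  obtain ⟨c, hc, hc'⟩ := factor (ρ := ρB) i ii hi (s ∘ₗ i') (hs.comp hi') (fun v => (ex _).1 (by
    simp [hs', ex'.apply_apply_eq_zero]))
  refine hB.retract₂ hP.pp a i c b ha hi hc hb fun v => ii ?_
  rw [map_add, hb', hc']
  simp [ha']

theorem ep_of_exact [Fintype G] {ρM : Representation F G V} {ρP : Representation F G W}
    {ρL : Representation F G U} (i : V →ₗ[F] W) (q : W →ₗ[F] U)
    (hi : Equi ρM ρP i) (hq : Equi ρP ρL q) (ii : Function.Injective i)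
    (sq : Function.Surjective q) (ex : Function.Exact i q) (hP : HP ρP) (hL : PP ρL) :
    EP ρM := by
  have idE : ∀ {V : Type} [AddCommGroup V] [Module F V] (ρ : Representation F G V),
    Equi ρ ρ LinearMap.id := fun ρ g v => rfl
  have exD : Function.Exact (Module.Dual.transpose (R := F) q)
      (Module.Dual.transpose (R := F) i) := by
    intro f
    constructor
    · intro h
      obtain ⟨s, hs⟩ := q.exists_rightInverse_of_surjective (LinearMap.range_eq_top.2 sq)
      have hs' : ∀ x, q (s x) = x := fun x => LinearMap.congr_fun hs x
      refine ⟨f ∘ₗ s, ?_⟩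
      ext x
      obtain ⟨y, hy⟩ := (ex (x - s (q x))).1 (by simp [hs'])
      have h0 := LinearMap.congr_fun h y
      simp only [Module.Dual.transpose_apply, LinearMap.comp_apply, LinearMap.zero_apply, hy,
        map_sub] at h0 ⊢
      exact (sub_eq_zero.1 h0).symm
    · rintro ⟨f, rfl⟩
      ext v
      simp [Module.Dual.transpose_apply, ex.apply_apply_eq_zero]
  have sD : Function.Surjective (Module.Dual.transpose (R := F) i) :=
    LinearMap.dualMap_surjective_of_injective ii
  have iD : Function.Injective (Module.Dual.transpose (R := F) q) :=
    LinearMap.dualMap_injective_of_surjective sq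
  exact schanuel (ρA := ρM.tprod ρM.dual) (ρP := ρP.tprod ρM.dual) (ρC := ρL.tprod ρM.dual)
    (ρB := ρL.tprod ρL.dual) (ρQ := ρL.tprod ρP.dual)
    (TensorProduct.map i LinearMap.id) (TensorProduct.map q LinearMap.id)
    (TensorProduct.map LinearMap.id (Module.Dual.transpose (R := F) q))
    (TensorProduct.map LinearMap.id (Module.Dual.transpose (R := F) i))
    (hi.tmap (idE _)) (hq.tmap (idE _)) ((idE _).tmap hq.dual) ((idE _).tmap hi.dual)
    (Module.Flat.rTensor_preserves_injective_linearMap (M := Module.Dual F V) i ii)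
    (Module.Flat.lTensor_preserves_injective_linearMap (M := U) _ iD)
    (LinearMap.rTensor_surjective _ sq) (LinearMap.lTensor_surjective _ sD)
    (rTensor_exact (Module.Dual F V) ex sq) (lTensor_exact U exD sD)
    (hP.tprod_left _) (hP.dual.tprod_right _) (hL.tprod hL.dual)

/-- Permutation representation on finitely supported functions. -/
noncomputable def finRep (F G X : Type) [Field F] [Group G] [MulAction G X] :
    Representation F G (X →₀ F) where
  toFun g := Finsupp.lmapDomain F F (fun x : X => g • x)
  map_one' := by ext; simp
  map_mul' a b := by
    ext x : 2
    simp [mul_smul]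

theorem finRep_single {X : Type} [MulAction G X] (g : G) (x : X) (c : F) :
    finRep F G X g (Finsupp.single x c) = Finsupp.single (g • x) c := by
  simp [finRep]

theorem finRep_isPerm {X : Type} [MulAction G X] : IsPerm (finRep F G X) :=
  ⟨X, Finsupp.basisSingleOne, fun g x => ⟨g • x, by simp [finRep_single]⟩⟩

theorem PP.of_hom [Finite G] {H : Type} [Group H] (f : H →* G)
    (hf : ((Nat.card (G ⧸ f.range) : ℕ) : F) ≠ 0) {ρ : Representation F G V}
    (h : PP (ρ.comp f : Representation F H V)) : PP ρ := by
  classical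
  obtain ⟨W, _, _, τ, ⟨X, b, hb⟩, i, q, hi, hq, e⟩ := h
  let _ := permAct b hb
  have hs : ∀ (g : H) (x : X), τ g (b x) = b (g • x) := permAct_spec b hb
  have e' : ∀ v, q (i v) = v := fun v => LinearMap.congr_fun e v
  let S : Setoid (G × X) :=
    { r := fun a c => ∃ h : H, a.1 = c.1 * f h ∧ h • a.2 = c.2
      iseqv := ⟨fun a => ⟨1, by simp⟩,
        by
          rintro ⟨a, x⟩ ⟨c, y⟩ ⟨h, h1, h2⟩
          simp only at h1 h2
          refine ⟨h⁻¹, ?_, ?_⟩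
          · simp [h1]
          · simp [← h2],
        by
          rintro ⟨a, x⟩ ⟨c, y⟩ ⟨d, z⟩ ⟨h, h1, h2⟩ ⟨k, h3, h4⟩
          simp only at h1 h2 h3 h4
          refine ⟨k * h, ?_, ?_⟩
          · simp [h1, h3, mul_assoc]
          · simp [mul_smul, h2, h4]⟩ }
  let act : MulAction G (Quotient S) :=
    { smul := fun k => Quotient.map (fun a => (k * a.1, a.2)) (by
        rintro ⟨a, x⟩ ⟨c, y⟩ ⟨h, h1, h2⟩
        exact ⟨h, by simp only at h1; simp [h1, mul_assoc], h2⟩)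
      one_smul := by
        rintro ⟨a, x⟩
        exact congrArg (Quotient.mk S) (by simp)
      mul_smul := by
        rintro k l ⟨a, x⟩
        exact congrArg (Quotient.mk S) (by simp [mul_assoc]) }
  have hact : ∀ (k a : G) (x : X), k • (Quotient.mk S (a, x)) = Quotient.mk S (k * a, x) :=
    fun _ _ _ => rfl
  let mk : G → W →ₗ[F] (Quotient S →₀ F) := fun g =>
    b.constr F fun x => Finsupp.single (Quotient.mk S (g, x)) 1
  have mk_b : ∀ g x, mk g (b x) = Finsupp.single (Quotient.mk S (g, x)) 1 := by
    intro g x; simp [mk]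
  have mk_h : ∀ (g : G) (h : H) (w : W), mk (g * f h) w = mk g (τ h w) := by
    intro g h w
    suffices H : mk (g * f h) = mk g ∘ₗ τ h from LinearMap.congr_fun H w
    apply b.ext
    intro x
    simp only [LinearMap.comp_apply, hs, mk_b]
    congr 1
    exact Quotient.sound ⟨h, rfl, rfl⟩
  have mk_k : ∀ (k g : G) (w : W), finRep F G (Quotient S) k (mk g w) = mk (k * g) w := by
    intro k g w
    suffices H : finRep F G (Quotient S) k ∘ₗ mk g = mk (k * g) from LinearMap.congr_fun H w
    apply b.ext
    intro x
    simp only [LinearMap.comp_apply, mk_b, finRep_single, hact]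
  let A : G → V →ₗ[F] (Quotient S →₀ F) := fun g => mk g ∘ₗ i ∘ₗ ρ g⁻¹
  have A_h : ∀ g h, A (g * f h) = A g := by
    intro g h
    ext1 v
    simp only [A, LinearMap.comp_apply, mk_h]
    congr 1
    have := hi h (ρ (g * f h)⁻¹ v)
    rw [← this]
    congr 1
    simp [← Module.End.mul_apply, ← map_mul]
  have A_out : ∀ g, A (Quotient.out (QuotientGroup.mk (s := f.range) g)) = A g := by
    intro g
    obtain ⟨⟨_, h, rfl⟩, hh⟩ := QuotientGroup.mk_out_eq_mul f.range g
    rw [hh]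
    exact A_h g h
  have A_k : ∀ k g v, A (k * g) (ρ k v) = finRep F G (Quotient S) k (A g v) := by
    intro k g v
    simp only [A, LinearMap.comp_apply, mk_k]
    congr 2
    simp [← Module.End.mul_apply, ← map_mul]
  let _ := Fintype.ofFinite (G ⧸ f.range)
  let c : F := (Fintype.card (G ⧸ f.range) : ℕ)
  have hc : c ≠ 0 := by rwa [Nat.card_eq_fintype_card] at hf
  let I : V →ₗ[F] (Quotient S →₀ F) := ∑ t : G ⧸ f.range, A t.out
  let Q : (Quotient S →₀ F) →ₗ[F] V := Finsupp.lift V F (Quotient S) (Quotient.lift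
    (fun a : G × X => ρ a.1 (q (b a.2))) (by
      rintro ⟨a, x⟩ ⟨d, y⟩ ⟨h, h1, h2⟩
      simp only at h1 h2 ⊢
      have := hq h (b x)
      rw [hs, h2] at this
      rw [this, h1, map_mul]
      rfl))
  have Qmk : ∀ g w, Q (mk g w) = ρ g (q w) := by
    intro g w
    suffices H : Q ∘ₗ mk g = ρ g ∘ₗ q from LinearMap.congr_fun H w
    apply b.ext
    intro x
    simp [mk_b, Q]
  refine (finRep_isPerm (F := F) (G := G) (X := Quotient S)).pp.retract (c⁻¹ • I) Q ?_ ?_ ?_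
  · intro g v
    simp only [LinearMap.smul_apply, map_smul, I, LinearMap.sum_apply, map_sum]
    congr 1
    rw [← Equiv.sum_comp (MulAction.toPerm g)]
    refine Finset.sum_congr rfl fun t _ => ?_
    rw [← A_k, ← A_out (g * t.out)]
    congr 3
    simp only [MulAction.toPerm_apply]
    conv_lhs => rw [← QuotientGroup.out_eq' t]
    rfl
  · intro g w
    suffices H : Q ∘ₗ finRep F G (Quotient S) g = ρ g ∘ₗ Q from LinearMap.congr_fun H w
    ext ⟨a, x⟩
    have : (Quot.mk S (a, x)) = Quotient.mk S (a, x) := rfl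
    simp [this, finRep_single, hact, Q]
  · intro v
    simp only [LinearMap.smul_apply, map_smul, I, LinearMap.sum_apply, map_sum]
    have : ∀ t : G ⧸ f.range, Q (A t.out v) = v := by
      intro t
      simp [A, Qmk, e']
    simp only [this, Finset.sum_const, Finset.card_univ]
    rw [← Nat.cast_smul_eq_nsmul F, smul_smul, inv_mul_cancel₀ hc, one_smul]

theorem EP.of_hom [Finite G] {H : Type} [Group H] (f : H →* G)
    (hf : ((Nat.card (G ⧸ f.range) : ℕ) : F) ≠ 0) {ρ : Representation F G V}
    (h : EP (ρ.comp f : Representation F H V)) : EP ρ := by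
  refine PP.of_hom f hf ?_
  have e : (MonoidHom.comp (ρ.tprod ρ.dual) f : Representation F H _) =
      Representation.tprod (MonoidHom.comp ρ f : Representation F H V)
        (Representation.dual (MonoidHom.comp ρ f : Representation F H V)) := by
    refine MonoidHom.ext fun g => ?_
    simp [Representation.tprod_apply, Representation.dual_apply]
  rw [e]
  exact h

end Higman

end LieEP

namespace LieEP

section Conv

variable {F G : Type} [Field F] [Group G]
variable {V W : Type} [AddCommGroup V] [Module F V] [AddCommGroup W] [Module F W]
variable {N N' : Type} [AddCommGroup N] [Module F N] [Module (MonoidAlgebra F G) N]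
  [IsScalarTower F (MonoidAlgebra F G) N]
  [AddCommGroup N'] [Module F N'] [Module (MonoidAlgebra F G) N']
  [IsScalarTower F (MonoidAlgebra F G) N']

/-- The representation attached to a module. -/
noncomputable abbrev mrep (F G N : Type) [Field F] [Group G] [AddCommGroup N] [Module F N]
    [Module (MonoidAlgebra F G) N] [IsScalarTower F (MonoidAlgebra F G) N] :
    Representation F G N := Representation.ofModule' (k := F) (G := G) N

theorem mrep_apply (g : G) (v : N) : mrep F G N g v = MonoidAlgebra.single g (1 : F) • v := by
  simp [mrep, Representation.ofModule']

theorem asModule_single (ρ : Representation F G V) (g : G) (v : ρ.asModule) :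
    MonoidAlgebra.single g (1 : F) • v = (ρ g (ρ.asModuleEquiv v) : V) := by
  rw [Representation.single_smul, one_smul]

theorem mrep_asModule (ρ : Representation F G V) (g : G) (v : ρ.asModule) :
    mrep F G ρ.asModule g v = (ρ g (ρ.asModuleEquiv v) : V) := by
  rw [mrep_apply, asModule_single]

theorem linear_equi (f : N →ₗ[MonoidAlgebra F G] N') :
    Equi (mrep F G N) (mrep F G N') (f.restrictScalars F) := by
  intro g v
  simp [mrep_apply]

/-- Equivariant maps are linear over the group algebra. -/
noncomputable def toLin (f : N →ₗ[F] N') (h : Equi (mrep F G N) (mrep F G N') f) :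
    N →ₗ[MonoidAlgebra F G] N' :=
  MonoidAlgebra.equivariantOfLinearOfComm f (fun g v => by
    have := h g v
    rwa [mrep_apply, mrep_apply] at this)

theorem toLin_apply (f : N →ₗ[F] N') (h : Equi (mrep F G N) (mrep F G N') f) (v : N) :
    toLin f h v = f v := rfl

theorem ofMulAction_isPerm (X : Type) [MulAction G X] :
    IsPerm (Representation.ofMulAction F G X) := by
  refine ⟨X, ⟨MonoidAlgebra.coeffLinearEquiv F⟩, fun g x => ⟨g • x, ?_⟩⟩
  simp [Module.Basis.coe_ofRepr, Representation.ofMulAction_def]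

theorem pp_of_isPP (h : isPPermutationModule F G N) : PP (mrep F G N) := by
  obtain ⟨X, _, ι, π, e⟩ := h
  refine ⟨_, _, _, Representation.ofMulAction F G X, ofMulAction_isPerm X,
    ι.restrictScalars F, π.restrictScalars F, ?_, ?_, ?_⟩
  · intro g v
    exact (linear_equi ι g v).trans (mrep_asModule _ _ _)
  · intro g v
    refine Eq.trans ?_ (linear_equi π g v)
    exact congrArg π (mrep_asModule (Representation.ofMulAction F G X) g v).symm
  · ext v
    exact LinearMap.congr_fun e v

theorem isPP_of_pp (h : PP (mrep F G N)) : isPPermutationModule F G N := by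
  obtain ⟨W, _, _, σ, ⟨X, b, hb⟩, i, q, hi, hq, e⟩ := h
  let _ := permAct b hb
  let E : W ≃ₗ[F] MonoidAlgebra F X := b.repr.trans (MonoidAlgebra.coeffLinearEquiv F).symm
  have hE : ∀ g w, E (σ g w) = Representation.ofMulAction F G X g (E w) := by
    intro g w
    suffices h : E.toLinearMap ∘ₗ σ g = Representation.ofMulAction F G X g ∘ₗ E.toLinearMap from
      LinearMap.congr_fun h w
    apply b.ext
    intro x
    have : σ g (b x) = b (g • x) := permAct_spec b hb g x
    simp [E, this, Representation.ofMulAction_def]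
  have hE' : ∀ g w, E.symm (Representation.ofMulAction F G X g w) = σ g (E.symm w) := by
    intro g w
    rw [LinearEquiv.symm_apply_eq, hE, LinearEquiv.apply_symm_apply]
  let i' : N →ₗ[F] (Representation.ofMulAction F G X).asModule := E.toLinearMap ∘ₗ i
  let q' : (Representation.ofMulAction F G X).asModule →ₗ[F] N := q ∘ₗ E.symm.toLinearMap
  refine ⟨X, inferInstance, toLin i' ?_, toLin q' ?_, ?_⟩
  · intro g v
    rw [mrep_asModule]
    exact (congrArg E (hi g v)).trans (hE _ _)
  · intro g v
    rw [mrep_asModule]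
    exact Eq.trans (congrArg q (hE' g v)) (hq g (E.symm v))
  · ext v
    have : q (E.symm (E (i v))) = v := by
      rw [LinearEquiv.symm_apply_apply]; exact LinearMap.congr_fun e v
    exact this

theorem isPP_asModule {ρ : Representation F G V} (h : PP ρ) :
    isPPermutationModule F G ρ.asModule := by
  refine isPP_of_pp (N := ρ.asModule) ?_
  refine h.retract ρ.asModuleEquiv.toLinearMap ρ.asModuleEquiv.symm.toLinearMap ?_ ?_ ?_
  · intro g v
    rw [mrep_asModule]; rfl
  · intro g v
    rw [mrep_asModule]; rfl
  · intro v; rfl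

theorem isPP_tprod_dual {ρ : Representation F G V} (h : EP ρ) :
    isPPermutationModule F G (ρ.tprod ρ.dual).asModule :=
  isPP_asModule h

theorem HP_of_projective [Fintype G] (h : Module.Projective (MonoidAlgebra F G) N) :
    HP (mrep F G N) := by
  classical
  obtain ⟨s, hs⟩ := h.out
  let q := Finsupp.linearCombination (MonoidAlgebra F G) (id : N → N)
  have hfree : HP (mrep F G (N →₀ MonoidAlgebra F G)) := by
    let t : MonoidAlgebra F G →ₗ[F] MonoidAlgebra F G :=
      (MonoidAlgebra.coeffLinearEquiv F).symm.toLinearMap ∘ₗ Finsupp.lsingle (1 : G) ∘ₗ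
        Finsupp.lapply (1 : G) ∘ₗ (MonoidAlgebra.coeffLinearEquiv F).toLinearMap
    refine ⟨Finsupp.mapRange.linearMap t, fun v => ?_⟩
    induction v using Finsupp.induction_linear with
    | zero => simp
    | add x y hx hy => simp only [map_add, Finset.sum_add_distrib, hx, hy]
    | single n a =>
      induction a using MonoidAlgebra.induction_linear with
      | zero => simp
      | add x y hx hy => simp only [map_add, Finsupp.single_add, Finset.sum_add_distrib, hx, hy]
      | single g c =>
        rw [Finset.sum_eq_single g]
        · simp [mrep_apply, t, MonoidAlgebra.single_mul_single]
        · intro b _ hb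
          have : b⁻¹ * g ≠ 1 := by
            intro h
            exact hb (inv_mul_eq_one.1 h)
          simp [mrep_apply, t, MonoidAlgebra.single_mul_single, this]
        · simp
  refine hfree.retract (s.restrictScalars F) (q.restrictScalars F) (linear_equi s)
    (linear_equi q) hs

theorem proj_zero [Fintype G] {P₁ : Type} [AddCommGroup P₁] [Module F P₁]
    [Module (MonoidAlgebra F G) P₁] [IsScalarTower F (MonoidAlgebra F G) P₁]
    (π : N →ₗ[MonoidAlgebra F G] N')
    (hess : ∀ Q : Submodule (MonoidAlgebra F G) N, Q ⊔ LinearMap.ker π = ⊤ → Q = ⊤)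
    (j : P₁ →ₗ[MonoidAlgebra F G] N) (hj : Function.Injective j) (hπj : ∀ x, π (j x) = 0)
    (hP : Module.Projective (MonoidAlgebra F G) P₁) (x : P₁) : x = 0 := by
  obtain ⟨θ, hθ⟩ := HP_of_projective (F := F) hP
  obtain ⟨r0, hr0⟩ := (j.restrictScalars F).exists_leftInverse_of_injective
    (LinearMap.ker_eq_bot.2 hj)
  have hr0' : ∀ v, r0 (j v) = v := fun v => LinearMap.congr_fun hr0 v
  let r := toLin (trMap (mrep F G N) (mrep F G P₁) (θ ∘ₗ r0)) (trMap_equi _ _ _)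
  have hr : ∀ v, r (j v) = v := by
    intro v
    change trMap (mrep F G N) (mrep F G P₁) (θ ∘ₗ r0) (j v) = v
    rw [trMap_apply]
    refine Eq.trans (Finset.sum_congr rfl fun g _ => ?_) (hθ v)
    have : mrep F G N g⁻¹ (j v) = j (mrep F G P₁ g⁻¹ v) := (linear_equi j g⁻¹ v).symm
    rw [this, LinearMap.comp_apply, hr0']
  have hR : LinearMap.ker r = ⊤ := by
    apply hess
    rw [eq_top_iff]
    intro y _
    have : y = (y - j (r y)) + j (r y) := by abel
    rw [this]
    refine Submodule.add_mem_sup ?_ ?_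
    · simp [LinearMap.mem_ker, hr]
    · simp [LinearMap.mem_ker, hπj]
  have : j x ∈ LinearMap.ker r := hR ▸ Submodule.mem_top
  rw [LinearMap.mem_ker, hr] at this
  exact this

theorem ep_main [Fintype G] {ρ : Representation F G V} {K P₂ : Type}
    [AddCommGroup K] [Module F K]
    [Module (MonoidAlgebra F G) K] [IsScalarTower F (MonoidAlgebra F G) K]
    [AddCommGroup P₂] [Module F P₂]
    [Module (MonoidAlgebra F G) P₂] [IsScalarTower F (MonoidAlgebra F G) P₂]
    (π : N →ₗ[MonoidAlgebra F G] N') (hπ : Function.Surjective π)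
    (e : ρ.asModule ≃ₗ[MonoidAlgebra F G] (K × P₂))
    (eK : K ≃ₗ[MonoidAlgebra F G] LinearMap.ker π)
    (hP : Module.Projective (MonoidAlgebra F G) N)
    (hP₂ : Module.Projective (MonoidAlgebra F G) P₂)
    (hL : isPPermutationModule F G N') : EP ρ := by
  let i₀ : ρ.asModule →ₗ[MonoidAlgebra F G] N × P₂ :=
    (LinearMap.prodMap ((LinearMap.ker π).subtype ∘ₗ eK.toLinearMap) LinearMap.id) ∘ₗ e.toLinearMap
  let q₀ : N × P₂ →ₗ[MonoidAlgebra F G] N' := π ∘ₗ LinearMap.fst _ _ _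
  let i : V →ₗ[F] N × P₂ := (i₀.restrictScalars F) ∘ₗ ρ.asModuleEquiv.symm.toLinearMap
  have hpr : ∀ g v, (mrep F G N).prod (mrep F G P₂) g v = mrep F G (N × P₂) g v := by
    intro g v
    rw [mrep_apply]
    ext <;> simp [Representation.prod, mrep_apply]
  refine ep_of_exact (ρP := (mrep F G N).prod (mrep F G P₂)) (ρL := mrep F G N') i
    (q₀.restrictScalars F) ?_ ?_ ?_ ?_ ?_
    ((HP_of_projective hP).prod (HP_of_projective hP₂)) (pp_of_isPP hL)
  · intro g v
    rw [hpr]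
    refine Eq.trans ?_ (linear_equi i₀ g v)
    exact congrArg i₀ (mrep_asModule ρ g v).symm
  · intro g v
    rw [hpr]
    exact linear_equi q₀ g v
  · intro v w h
    have h1 : i₀ v = i₀ w := h
    apply e.injective
    have h2 : ((eK (e v).1 : N), (e v).2) = ((eK (e w).1 : N), (e w).2) := h1
    rw [Prod.mk.injEq] at h2
    refine Prod.ext (eK.injective (Subtype.ext h2.1)) h2.2
  · intro y
    obtain ⟨x, hx⟩ := hπ y
    exact ⟨(x, 0), hx⟩
  · rintro ⟨x, y⟩
    constructor
    · intro h
      have h1 : π x = 0 := h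
      refine ⟨e.symm (eK.symm ⟨x, h1⟩, y), ?_⟩
      have : i₀ (e.symm (eK.symm ⟨x, h1⟩, y)) = (x, y) := by
        simp [i₀]
      exact this
    · rintro ⟨v, hv⟩
      have h2 : ((eK (e v).1 : N), (e v).2) = (x, y) := hv
      rw [Prod.mk.injEq] at h2
      have h3 : π x = 0 := by rw [← h2.1]; exact (eK (e v).1).2
      exact h3

end Conv

theorem part_one (F : Type) [Field F] (G : Type) [Group G] [Finite G]
    (V : Type) [AddCommGroup V] [Module F V] (ρ : Representation F G V)
    (L : ModuleCat.{0} (MonoidAlgebra F G))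
    (hL : isOmegaZPow (-1) (ModuleCat.of (MonoidAlgebra F G) ρ.asModule) L)
    (hLperm : isPPermutationModule F G ↥L) :
    (∃ K Q : ModuleCat.{0} (MonoidAlgebra F G), isSyzygy L K ∧
        Module.Projective (MonoidAlgebra F G) Q ∧
        Nonempty (ρ.asModule ≃ₗ[MonoidAlgebra F G] (↥K × ↥Q))) ∧
      isPPermutationModule F G (ρ.tprod ρ.dual).asModule := by
  have := Fintype.ofFinite G
  obtain ⟨-, M₀, ⟨-, P₂, hP₂, ⟨e₂⟩⟩, K, hsyz, -, P₁, hP₁, ⟨e₁⟩⟩ := hL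
  obtain ⟨P, π, hP, hπ, hess, ⟨eK⟩⟩ := id hsyz
  let _ : Module F P₁ := Module.compHom P₁ (algebraMap F (MonoidAlgebra F G))
  let _ : Module F P₂ := Module.compHom P₂ (algebraMap F (MonoidAlgebra F G))
  let _ : Module F P := Module.compHom P (algebraMap F (MonoidAlgebra F G))
  let _ : Module F K := Module.compHom K (algebraMap F (MonoidAlgebra F G))
  let _ : Module F L := Module.compHom L (algebraMap F (MonoidAlgebra F G))
  have _ : IsScalarTower F (MonoidAlgebra F G) P₁ :=
    IsScalarTower.of_algebraMap_smul fun _ _ => rfl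
  have _ : IsScalarTower F (MonoidAlgebra F G) P₂ :=
    IsScalarTower.of_algebraMap_smul fun _ _ => rfl
  have _ : IsScalarTower F (MonoidAlgebra F G) P :=
    IsScalarTower.of_algebraMap_smul fun _ _ => rfl
  have _ : IsScalarTower F (MonoidAlgebra F G) K :=
    IsScalarTower.of_algebraMap_smul fun _ _ => rfl
  have _ : IsScalarTower F (MonoidAlgebra F G) L :=
    IsScalarTower.of_algebraMap_smul fun _ _ => rfl
  have z : ∀ x : P₁, x = 0 := by
    intro x
    refine proj_zero (F := F) π hess ((LinearMap.ker π).subtype ∘ₗ eK.toLinearMap ∘ₗ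
      e₁.symm.toLinearMap ∘ₗ LinearMap.inr _ _ _) ?_ ?_ hP₁ x
    · exact Subtype.val_injective.comp (eK.injective.comp (e₁.symm.injective.comp
        LinearMap.inr_injective))
    · intro x
      exact (eK (e₁.symm (0, x))).2
  let e₃ : ↥K ≃ₗ[MonoidAlgebra F G] ↥M₀ := e₁.trans
    (LinearEquiv.ofBijective (LinearMap.fst (MonoidAlgebra F G) M₀ P₁)
      ⟨fun a b h => Prod.ext h ((z _).trans (z _).symm), LinearMap.fst_surjective⟩)
  let e : ρ.asModule ≃ₗ[MonoidAlgebra F G] (↥K × ↥P₂) :=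
    e₂.trans (LinearEquiv.prodCongr e₃.symm (LinearEquiv.refl _ _))
  exact ⟨⟨K, P₂, hsyz, hP₂, ⟨e⟩⟩, isPP_tprod_dual (ep_main π hπ e eK hP hP₂ hLperm)⟩

end LieEP

namespace LieEP

section Words

variable {F : Type} [Field F] {α β γ : Type}

/-- The free associative algebra, as the monoid algebra of words. -/
abbrev T (F α : Type) [Field F] := MonoidAlgebra F (FreeMonoid α)

/-- A word. -/
noncomputable def wd (F : Type) [Field F] {α : Type} (l : List α) : T F α :=
  MonoidAlgebra.single (FreeMonoid.ofList l) 1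

/-- A letter. -/
noncomputable def ltr (F : Type) [Field F] {α : Type} (x : α) : T F α := wd F [x]

theorem wd_nil : wd F ([] : List α) = 1 := rfl

theorem wd_append (l m : List α) : wd F (l ++ m) = wd F l * wd F m := by
  simp [wd, MonoidAlgebra.single_mul_single, FreeMonoid.ofList_append]

theorem wd_cons (x : α) (m : List α) : wd F (x :: m) = ltr F x * wd F m :=
  wd_append [x] m

theorem wd_eq_prod (l : List α) : wd F l = (l.map (ltr F)).prod := by
  induction l with
  | nil => rfl
  | cons x l ih => rw [wd_cons, ih, List.map_cons, List.prod_cons]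

/-- Universal property. -/
noncomputable def tlift {B : Type} [Ring B] [Algebra F B] (f : α → B) : T F α →ₐ[F] B :=
  MonoidAlgebra.lift F B (FreeMonoid α) (FreeMonoid.lift f)

theorem tlift_ltr {B : Type} [Ring B] [Algebra F B] (f : α → B) (x : α) :
    tlift f (ltr F x) = f x := by
  have : FreeMonoid.ofList [x] = FreeMonoid.of x := rfl
  simp [tlift, ltr, wd, this]

theorem tlift_wd {B : Type} [Ring B] [Algebra F B] (f : α → B) (l : List α) :
    tlift f (wd F l) = (l.map f).prod := by
  rw [wd_eq_prod, map_list_prod, List.map_map]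
  congr 1
  exact List.map_congr_left fun x _ => tlift_ltr f x

theorem lin_ext {B : Type} [AddCommGroup B] [Module F B] {f g : T F α →ₗ[F] B}
    (h : ∀ l, f (wd F l) = g (wd F l)) : f = g := by
  refine LinearMap.ext fun v => ?_
  induction v using MonoidAlgebra.induction_linear with
  | zero => simp
  | add x y hx hy => simp [hx, hy]
  | single w c =>
    have : MonoidAlgebra.single w c = c • wd F (FreeMonoid.toList w) := by
      simp [wd]
    rw [this, map_smul, map_smul, h]

theorem T_induction {P : T F α → Prop} (h0 : P 0) (hadd : ∀ x y, P x → P y → P (x + y))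
    (hw : ∀ (c : F) l, P (c • wd F l)) (v : T F α) : P v := by
  induction v using MonoidAlgebra.induction_linear with
  | zero => exact h0
  | add x y hx hy => exact hadd x y hx hy
  | single w c =>
    have : MonoidAlgebra.single w c = c • wd F (FreeMonoid.toList w) := by
      simp [wd]
    rw [this]; exact hw _ _

theorem alg_ext {B : Type} [Ring B] [Algebra F B] {f g : T F α →ₐ[F] B}
    (h : ∀ x, f (ltr F x) = g (ltr F x)) : f = g := by
  have : f.toLinearMap = g.toLinearMap := by
    refine lin_ext fun l => ?_
    change f (wd F l) = g (wd F l)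
    rw [wd_eq_prod, map_list_prod, map_list_prod, List.map_map, List.map_map]
    congr 1
    exact List.map_congr_left fun x _ => h x
  exact AlgHom.ext fun v => LinearMap.congr_fun this v

/-- Linear functional/linear map out of the word basis. -/
noncomputable def wlift {B : Type} [AddCommGroup B] [Module F B] (f : List α → B) :
    T F α →ₗ[F] B :=
  (Finsupp.lsum F fun w : FreeMonoid α => LinearMap.toSpanSingleton F B (f (FreeMonoid.toList w)))
    ∘ₗ (MonoidAlgebra.coeffLinearEquiv F).toLinearMap

theorem wlift_wd {B : Type} [AddCommGroup B] [Module F B] (f : List α → B) (l : List α) :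
    wlift f (wd F l) = f l := by
  simp [wlift, wd]

/-- Relabelling. -/
noncomputable def tmap (f : α → β) : T F α →ₐ[F] T F β := tlift fun x => ltr F (f x)

theorem tmap_ltr (f : α → β) (x : α) : tmap f (ltr F x) = ltr F (f x) := tlift_ltr _ _

theorem tmap_wd (f : α → β) (l : List α) : tmap f (wd F l) = wd F (l.map f) := by
  rw [tmap, tlift_wd, wd_eq_prod, List.map_map]; rfl

theorem tmap_tmap (f : α → β) (g : β → γ) (v : T F α) :
    tmap g (tmap f v) = tmap (g ∘ f) v := by
  have : ((tmap g).comp (tmap f) : T F α →ₐ[F] T F γ) = tmap (g ∘ f) := by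
    apply alg_ext; intro x
    simp [tmap_ltr]
  exact AlgHom.congr_fun this v

theorem tmap_id (v : T F α) : tmap id v = v := by
  have : (tmap id : T F α →ₐ[F] T F α) = AlgHom.id F _ := by
    apply alg_ext; intro x
    simp [tmap_ltr]
  exact AlgHom.congr_fun this v

/-- The relabelling representation. -/
noncomputable def tRep (F α : Type) [Field F] : Representation F (Equiv.Perm α) (T F α) where
  toFun s := (tmap s : T F α →ₐ[F] T F α).toLinearMap
  map_one' := LinearMap.ext fun v => tmap_id v
  map_mul' a b := LinearMap.ext fun v => (tmap_tmap b a v).symm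

theorem tRep_apply (s : Equiv.Perm α) (v : T F α) : tRep F α s v = tmap s v := rfl

end Words

section Brackets

variable {B C : Type} [Ring B] [Ring C]

/-- Left-normed bracket of a list. -/
def lnbs : List B → B
  | [] => 0
  | a :: l => l.foldl (fun x y => ⁅x, y⁆) a

theorem lnbs_singleton (a : B) : lnbs [a] = a := rfl

theorem lnbs_append (l : List B) (h : l ≠ []) (m : List B) :
    lnbs (l ++ m) = m.foldl (fun x y => ⁅x, y⁆) (lnbs l) := by
  cases l with
  | nil => exact absurd rfl h
  | cons a l => simp [lnbs, List.foldl_append]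

theorem lnbs_concat (l : List B) (h : l ≠ []) (z : B) : lnbs (l ++ [z]) = ⁅lnbs l, z⁆ := by
  rw [lnbs_append l h]; rfl

theorem map_lie_ring {E : Type} [FunLike E B C] [RingHomClass E B C] (f : E) (a b : B) :
    f ⁅a, b⁆ = ⁅f a, f b⁆ := by
  simp [Ring.lie_def]

theorem map_foldl_lie {E : Type} [FunLike E B C] [RingHomClass E B C] (f : E) (l : List B) (a : B) :
    f (l.foldl (fun x y => ⁅x, y⁆) a) = (l.map f).foldl (fun x y => ⁅x, y⁆) (f a) := by
  induction l generalizing a with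
  | nil => rfl
  | cons b l ih => simp only [List.foldl_cons, List.map_cons, ih, map_lie_ring]

theorem map_lnbs {E : Type} [FunLike E B C] [RingHomClass E B C] (f : E) (l : List B) :
    f (lnbs l) = lnbs (l.map f) := by
  cases l with
  | nil => simp [lnbs]
  | cons a l => exact map_foldl_lie f l a

theorem lie_lnbs_mem {α : Type} {F : Type} [Field F] [Algebra F B]
    (J : Multiset α → Submodule F B) (f : α → B)
    (hJ : ∀ S, ∀ a ∈ J S, ∀ z, ⁅a, f z⁆ ∈ J (S + {z})) (l : List α) :
    ∀ S, ∀ a ∈ J S, ⁅a, lnbs (l.map f)⁆ ∈ J (S + (l : Multiset α)) := by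
  induction l using List.reverseRecOn with
  | nil => intro S a _; simp [lnbs, Ring.lie_def]
  | append_singleton l z ih =>
    intro S a ha
    by_cases hl : l = []
    · subst hl
      simpa [lnbs] using hJ S a ha z
    · have hl' : l.map f ≠ [] := by simpa using hl
      rw [List.map_append, List.map_singleton, lnbs_concat _ hl']
      have e : ⁅a, ⁅lnbs (l.map f), f z⁆⁆ =
          ⁅⁅a, lnbs (l.map f)⁆, f z⁆ - ⁅⁅a, f z⁆, lnbs (l.map f)⁆ := by
        simp only [Ring.lie_def]; noncomm_ring
      rw [e]
      have h1 := hJ _ _ (ih S a ha) z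
      have h2 := ih _ _ (hJ S a ha z)
      refine Submodule.sub_mem _ ?_ ?_
      · have : S + ((l ++ [z] : List α) : Multiset α) = S + (l : Multiset α) + {z} := by
          rw [← Multiset.coe_add, add_assoc]; rfl
        rw [this]; exact h1
      · have : S + ((l ++ [z] : List α) : Multiset α) = S + {z} + (l : Multiset α) := by
          rw [← Multiset.coe_add, add_assoc, add_comm ({z} : Multiset α)]; rfl
        rw [this]; exact h2

end Brackets

section LieParts

variable {F : Type} [Field F] {α β : Type}

/-- The left-normed bracket of letters. -/
noncomputable def lw (F : Type) [Field F] {α : Type} (l : List α) : T F α := lnbs (l.map (ltr F))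

theorem lw_nil : lw F ([] : List α) = 0 := rfl

theorem lw_singleton (x : α) : lw F [x] = ltr F x := rfl

theorem lw_concat (l : List α) (h : l ≠ []) (z : α) : lw F (l ++ [z]) = ⁅lw F l, ltr F z⁆ := by
  have hl' : l.map (ltr F) ≠ [] := by simpa using h
  rw [lw, List.map_append, List.map_singleton, lnbs_concat _ hl']; rfl

theorem tmap_lw (f : α → β) (l : List α) : tmap f (lw F l) = lw F (l.map f) := by
  rw [lw, map_lnbs, lw, List.map_map, List.map_map]
  congr 1
  exact List.map_congr_left fun x _ => tmap_ltr f x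

/-- The multihomogeneous part of the free Lie algebra. -/
noncomputable def LL (F : Type) [Field F] {α : Type} (S : Multiset α) : Submodule F (T F α) :=
  Submodule.span F {v | ∃ l : List α, (l : Multiset α) = S ∧ v = lw F l}

theorem lw_mem_LL (l : List α) : lw F l ∈ LL F (l : Multiset α) :=
  Submodule.subset_span ⟨l, rfl, rfl⟩

theorem LL_step (S : Multiset α) (a : T F α) (ha : a ∈ LL F S) (z : α) :
    ⁅a, ltr F z⁆ ∈ LL F (S + {z}) := by
  induction ha using Submodule.span_induction with
  | mem x hx =>
    obtain ⟨l, rfl, rfl⟩ := hx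
    by_cases hl : l = []
    · subst hl
      simp [lw_nil, Ring.lie_def]
    · rw [← lw_concat l hl]
      exact lw_mem_LL (l ++ [z])
  | zero => simp [Ring.lie_def]
  | add x y _ _ hx hy =>
    have : ⁅x + y, ltr F z⁆ = ⁅x, ltr F z⁆ + ⁅y, ltr F z⁆ := by
      simp only [Ring.lie_def]; noncomm_ring
    rw [this]; exact Submodule.add_mem _ hx hy
  | smul c x _ hx =>
    have : ⁅c • x, ltr F z⁆ = c • ⁅x, ltr F z⁆ := by simp [Ring.lie_def, smul_sub]
    rw [this]; exact Submodule.smul_mem _ _ hx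

theorem lie_lw_mem (a b : List α) :
    ⁅lw F a, lw F b⁆ ∈ LL F ((a : Multiset α) + (b : Multiset α)) :=
  lie_lnbs_mem (fun S => LL F S) (ltr F) LL_step b _ _ (lw_mem_LL a)

end LieParts

end LieEP

namespace LieEP

open TensorProduct

section Filtration

variable {F : Type} [Field F] {α β : Type}

/-- Product of left-normed brackets. -/
noncomputable def pl (F : Type) [Field F] {α : Type} (ls : List (List α)) : T F α :=
  (ls.map (lw F)).prod

theorem pl_nil : pl F ([] : List (List α)) = 1 := rfl

theorem pl_cons (a : List α) (ls : List (List α)) : pl F (a :: ls) = lw F a * pl F ls := by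
  simp [pl]

theorem pl_append (ls ms : List (List α)) : pl F (ls ++ ms) = pl F ls * pl F ms := by
  simp [pl]

/-- Total content. -/
def mz (ls : List (List α)) : Multiset α := (ls.flatten : Multiset α)

theorem mz_nil : mz ([] : List (List α)) = 0 := rfl

theorem mz_cons (a : List α) (ls : List (List α)) : mz (a :: ls) = (a : Multiset α) + mz ls := by
  simp [mz]

theorem mz_append (ls ms : List (List α)) : mz (ls ++ ms) = mz ls + mz ms := by
  simp [mz]

theorem mz_perm {ls ms : List (List α)} (h : ls.Perm ms) : mz ls = mz ms :=
  Multiset.coe_eq_coe.2 h.flatten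

/-- The span of products of fewer than `r` left-normed brackets. -/
noncomputable def Fl (F : Type) [Field F] {α : Type} (r : ℕ) (S : Multiset α) :
    Submodule F (T F α) :=
  Submodule.span F {v | ∃ ls : List (List α), ls.length < r ∧ mz ls = S ∧ v = pl F ls}

theorem pl_mem {ls : List (List α)} {r : ℕ} {S : Multiset α} (h : ls.length < r) (hS : mz ls = S) :
    pl F ls ∈ Fl F r S :=
  Submodule.subset_span ⟨ls, h, hS, rfl⟩

theorem Fl_mono {r r' : ℕ} (h : r ≤ r') (S : Multiset α) : Fl F r S ≤ Fl F r' S := by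
  refine Submodule.span_le.2 ?_
  rintro v ⟨ls, hl, hS, rfl⟩
  exact pl_mem (hl.trans_le h) hS

theorem Fl_mul_pl {r r' : ℕ} {S S' : Multiset α} {a : T F α} (ha : a ∈ Fl F r S)
    (m : List (List α)) (hr : r + m.length = r') (hS : S + mz m = S') :
    a * pl F m ∈ Fl F r' S' := by
  induction ha using Submodule.span_induction with
  | mem x hx =>
    obtain ⟨ls, hl, rfl, rfl⟩ := hx
    rw [← pl_append]
    refine pl_mem ?_ (by rw [mz_append, hS])
    rw [List.length_append]; omega
  | zero => simp
  | add x y _ _ hx hy => rw [add_mul]; exact Submodule.add_mem _ hx hy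
  | smul c x _ hx => rw [smul_mul_assoc]; exact Submodule.smul_mem _ _ hx

theorem pl_mul_Fl {r r' : ℕ} {S S' : Multiset α} {a : T F α} (ha : a ∈ Fl F r S)
    (m : List (List α)) (hr : r + m.length = r') (hS : mz m + S = S') :
    pl F m * a ∈ Fl F r' S' := by
  induction ha using Submodule.span_induction with
  | mem x hx =>
    obtain ⟨ls, hl, rfl, rfl⟩ := hx
    rw [← pl_append]
    refine pl_mem ?_ (by rw [mz_append, hS])
    rw [List.length_append]; omega
  | zero => simp
  | add x y _ _ hx hy => rw [mul_add]; exact Submodule.add_mem _ hx hy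
  | smul c x _ hx => rw [mul_smul_comm]; exact Submodule.smul_mem _ _ hx

theorem LL_le_Fl (S : Multiset α) : LL F S ≤ Fl F 2 S := by
  refine Submodule.span_le.2 ?_
  rintro v ⟨l, rfl, rfl⟩
  have : lw F l = pl F [l] := by simp [pl]
  rw [this]
  exact pl_mem (by simp) (by simp [mz])

theorem pl_perm {ls ms : List (List α)} (h : ls.Perm ms) :
    pl F ls - pl F ms ∈ Fl F ls.length (mz ls) := by
  induction h with
  | nil => simp
  | @cons a l₁ l₂ _ ih =>
    rw [pl_cons, pl_cons, ← mul_sub]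
    have := pl_mul_Fl (r' := (a :: l₁).length) (S' := mz (a :: l₁)) ih [a] (by simp)
      (by simp [mz_cons, mz_nil])
    simpa [pl] using this
  | swap a b l =>
    have e : pl F (b :: a :: l) - pl F (a :: b :: l) = ⁅lw F b, lw F a⁆ * pl F l := by
      simp only [pl_cons, Ring.lie_def]; noncomm_ring
    rw [e]
    refine Fl_mul_pl (LL_le_Fl _ (lie_lw_mem b a)) l (by simp; omega) ?_
    rw [mz_cons, mz_cons, add_assoc]
  | @trans l₁ l₂ l₃ h₁ h₂ ih₁ ih₂ =>
    have := Submodule.add_mem _ ih₁ (h₁.length_eq ▸ mz_perm h₁ ▸ ih₂)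
    simpa using this

end Filtration

section Adams

variable {F : Type} [Field F] {α β : Type}

/-- The coproduct. -/
noncomputable def Del (F : Type) [Field F] (α : Type) : T F α →ₐ[F] T F α ⊗[F] T F α :=
  tlift fun x => ltr F x ⊗ₜ 1 + 1 ⊗ₜ ltr F x

theorem Del_ltr (x : α) : Del F α (ltr F x) = ltr F x ⊗ₜ 1 + 1 ⊗ₜ ltr F x := tlift_ltr _ _

theorem Del_lw (l : List α) : Del F α (lw F l) = lw F l ⊗ₜ 1 + 1 ⊗ₜ lw F l := by
  induction l using List.reverseRecOn with
  | nil => simp [lw_nil]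
  | append_singleton l z ih =>
    by_cases hl : l = []
    · subst hl
      exact Del_ltr z
    · rw [lw_concat l hl, map_lie_ring, ih, Del_ltr]
      simp only [Ring.lie_def, mul_add, add_mul, Algebra.TensorProduct.tmul_mul_tmul, one_mul,
        mul_one, TensorProduct.sub_tmul, TensorProduct.tmul_sub]
      abel

/-- The counit. -/
noncomputable def cou (F : Type) [Field F] (α : Type) : T F α →ₐ[F] F :=
  tlift fun _ => 0

theorem cou_lw (l : List α) : cou F α (lw F l) = 0 := by
  induction l using List.reverseRecOn with
  | nil => simp [lw_nil]
  | append_singleton l z ih =>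
    by_cases hl : l = []
    · subst hl
      exact tlift_ltr _ z
    · rw [lw_concat l hl, map_lie_ring, Ring.lie_def, ih]
      simp

/-- The Adams operations: convolution powers of the identity. -/
noncomputable def Psi (F : Type) [Field F] (α : Type) : ℕ → T F α →ₗ[F] T F α
  | 0 => Algebra.linearMap F (T F α) ∘ₗ (cou F α).toLinearMap
  | j + 1 => LinearMap.mul' F (T F α) ∘ₗ TensorProduct.map (Psi F α j) LinearMap.id ∘ₗ
      (Del F α).toLinearMap

theorem Psi_zero_apply (v : T F α) : Psi F α 0 v = algebraMap F (T F α) (cou F α v) := rfl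

theorem Psi_succ_apply (j : ℕ) (v : T F α) : Psi F α (j + 1) v =
    LinearMap.mul' F (T F α) (TensorProduct.map (Psi F α j) LinearMap.id (Del F α v)) := rfl

theorem Psi_step (j : ℕ)
    (ih : ∀ ls : List (List α), Psi F α j (pl F ls) - (j : F) ^ ls.length • pl F ls ∈
      Fl F ls.length (mz ls)) (l : List (List α)) :
    ∀ s t : List (List α), LinearMap.mul' F (T F α) (TensorProduct.map (Psi F α j) LinearMap.id
      ((pl F s ⊗ₜ pl F t) * Del F α (pl F l))) -
        ((j : F) ^ s.length * ((j : F) + 1) ^ l.length) • pl F (s ++ t ++ l) ∈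
      Fl F (s ++ t ++ l).length (mz (s ++ t ++ l)) := by
  induction l with
  | nil =>
    intro s t
    have e : LinearMap.mul' F (T F α) (TensorProduct.map (Psi F α j) LinearMap.id
      ((pl F s ⊗ₜ pl F t) * Del F α (pl F []))) -
        ((j : F) ^ s.length * ((j : F) + 1) ^ ([] : List (List α)).length) • pl F (s ++ t ++ []) =
        (Psi F α j (pl F s) - (j : F) ^ s.length • pl F s) * pl F t := by
      simp [pl_nil, pl_append, sub_mul]
    rw [e]
    refine Fl_mul_pl (ih s) t ?_ ?_
    · simp
    · simp [mz_append, mz_nil]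
  | cons a l ihl =>
    intro s t
    have h1 := ihl (s ++ [a]) t
    have h2 := ihl s (t ++ [a])
    have p1 : (s ++ [a] ++ t ++ l).Perm (s ++ t ++ (a :: l)) := by
      simp only [List.append_assoc, List.singleton_append]
      exact List.Perm.append_left s (List.perm_middle.symm)
    have q1 := pl_perm (F := F) p1
    have e2 : s ++ (t ++ [a]) ++ l = s ++ t ++ (a :: l) := by simp
    rw [e2] at h2
    rw [p1.length_eq, mz_perm p1] at h1 q1
    have h3 := Submodule.add_mem _ (Submodule.add_mem _ h1 h2)
      (Submodule.smul_mem _ ((j : F) ^ (s.length + 1) * ((j : F) + 1) ^ l.length) q1)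
    convert h3 using 1
    have e3 : Del F α (pl F (a :: l)) = (lw F a ⊗ₜ 1 + 1 ⊗ₜ lw F a) * Del F α (pl F l) := by
      rw [pl_cons, map_mul, Del_lw]
    have e4 : (pl F s ⊗ₜ[F] pl F t) * (lw F a ⊗ₜ 1 + 1 ⊗ₜ lw F a) =
        pl F (s ++ [a]) ⊗ₜ pl F t + pl F s ⊗ₜ pl F (t ++ [a]) := by
      simp [mul_add, pl_append, pl_cons, pl_nil]
    rw [e3, ← mul_assoc, e4, add_mul, map_add, map_add]
    simp only [List.length_append, List.length_cons, List.length_nil, zero_add, smul_sub]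
    module

theorem Psi_pl (j : ℕ) : ∀ ls : List (List α),
    Psi F α j (pl F ls) - (j : F) ^ ls.length • pl F ls ∈ Fl F ls.length (mz ls) := by
  induction j with
  | zero =>
    intro ls
    cases ls with
    | nil => rw [Psi_zero_apply, pl_nil, map_one, map_one]; simp
    | cons a l => simp [pl_cons, Psi_zero_apply, cou_lw]
  | succ j ih =>
    intro ls
    have := Psi_step j ih ls [] []
    rw [Psi_succ_apply]
    simpa [pl_nil, ← Algebra.TensorProduct.one_def] using this

theorem cou_tmap (f : α → β) (v : T F α) : cou F β (tmap f v) = cou F α v := by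
  have : ((cou F β).comp (tmap f)) = cou F α := by
    apply alg_ext; intro x
    simp [tmap_ltr, cou, tlift_ltr]
  exact AlgHom.congr_fun this v

theorem Del_tmap (f : α → β) (v : T F α) :
    Del F β (tmap f v) = Algebra.TensorProduct.map (tmap f) (tmap f) (Del F α v) := by
  have : ((Del F β).comp (tmap f)) =
      (Algebra.TensorProduct.map (tmap f) (tmap f)).comp (Del F α) := by
    apply alg_ext; intro x
    simp [tmap_ltr, Del_ltr]
  exact AlgHom.congr_fun this v

theorem Psi_tmap (f : α → β) (j : ℕ) (v : T F α) :
    Psi F β j (tmap f v) = tmap f (Psi F α j v) := by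
  induction j generalizing v with
  | zero => rw [Psi_zero_apply, Psi_zero_apply, cou_tmap, AlgHom.commutes]
  | succ j ih =>
    rw [Psi_succ_apply, Psi_succ_apply, Del_tmap]
    generalize Del F α v = w
    induction w with
    | zero => simp
    | add x y hx hy => simp only [map_add, hx, hy]
    | tmul x y => simp [ih]

end Adams

end LieEP

namespace LieEP

section Eul

variable {F : Type} [Field F] {α β : Type}

theorem sum_pow_range (p : ℕ) [hp : Fact p.Prime] [CharP F p] (i : ℕ) (hi : 0 < i) :
    ∑ j ∈ Finset.range p, (j : F) ^ i = if (p - 1) ∣ i then -1 else 0 := by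
  have h1 : ∑ x : ZMod p, x ^ i = if (p - 1) ∣ i then -1 else 0 := by
    have h := FiniteField.sum_pow_units (ZMod p) i
    rw [ZMod.card] at h
    rw [← h]
    have h2 : ∑ x : ZMod p, x ^ i = ∑ x ∈ Finset.univ \ {(0 : ZMod p)}, x ^ i := by
      rw [← Finset.sum_sdiff (Finset.subset_univ {(0 : ZMod p)})]
      simp [hi.ne']
    rw [h2]
    symm
    refine Finset.sum_bij (fun x _ => (x : ZMod p)) ?_ ?_ ?_ ?_
    · intro a _; simp
    · intro a _ b _ h; exact Units.ext h
    · intro b hb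
      refine ⟨Units.mk0 b (by simpa using hb), Finset.mem_univ _, rfl⟩
    · intro a _; simp
  have h3 := congrArg (ZMod.castHom (dvd_refl p) F) h1
  rw [map_sum] at h3
  have h4 : (ZMod.castHom (dvd_refl p) F) (if (p - 1) ∣ i then -1 else 0) =
      if (p - 1) ∣ i then -1 else 0 := by
    split_ifs <;> simp
  rw [← h4, ← h3]
  refine Finset.sum_bij (fun j _ => (j : ZMod p)) ?_ ?_ ?_ ?_
  · intro a _; exact Finset.mem_univ _
  · intro a ha b hb h
    rw [Finset.mem_range] at ha hb
    have := (ZMod.natCast_eq_natCast_iff' a b p).1 h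
    rwa [Nat.mod_eq_of_lt ha, Nat.mod_eq_of_lt hb] at this
  · intro b _
    exact ⟨b.val, Finset.mem_range.2 (ZMod.val_lt b), by simp⟩
  · intro a _; simp

/-- The Eulerian operator. -/
noncomputable def eul (F : Type) [Field F] (α : Type) (p : ℕ) : T F α →ₗ[F] T F α :=
  -∑ j ∈ Finset.range p, ((j : F) ^ (p - 2)) • Psi F α j

theorem eul_apply (p : ℕ) (v : T F α) :
    eul F α p v = -∑ j ∈ Finset.range p, ((j : F) ^ (p - 2)) • Psi F α j v := by
  simp [eul, LinearMap.sum_apply]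

theorem eul_tmap (p : ℕ) (f : α → β) (v : T F α) :
    eul F β p (tmap f v) = tmap f (eul F α p v) := by
  simp [eul_apply, Psi_tmap, map_sum]

theorem eul_pl (p : ℕ) [hp : Fact p.Prime] [CharP F p] (ls : List (List α)) (hl : 0 < ls.length) :
    eul F α p (pl F ls) - (if (p - 1) ∣ (p - 2 + ls.length) then (1 : F) else 0) • pl F ls ∈
      Fl F ls.length (mz ls) := by
  have h := sum_pow_range (F := F) p (p - 2 + ls.length) (by omega)
  have e : eul F α p (pl F ls) - (if (p - 1) ∣ (p - 2 + ls.length) then (1 : F) else 0) • pl F ls =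
      -∑ j ∈ Finset.range p, ((j : F) ^ (p - 2)) •
        (Psi F α j (pl F ls) - (j : F) ^ ls.length • pl F ls) := by
    have h5 : (if (p - 1) ∣ (p - 2 + ls.length) then (1 : F) else 0) =
        -∑ j ∈ Finset.range p, (j : F) ^ (p - 2 + ls.length) := by
      rw [h]; split_ifs <;> simp
    rw [h5, eul_apply]
    simp only [smul_sub, Finset.sum_sub_distrib, smul_smul, ← pow_add, ← Finset.sum_smul]
    rw [neg_smul]
    abel
  rw [e]
  refine Submodule.neg_mem _ (Submodule.sum_mem _ fun j _ => Submodule.smul_mem _ _ (Psi_pl j ls))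

variable (p : ℕ) [hp : Fact p.Prime] [CharP F p]

theorem Fl_one {S : Multiset α} (hS : S ≠ 0) : Fl F 1 S = ⊥ := by
  rw [eq_bot_iff]
  refine Submodule.span_le.2 ?_
  rintro v ⟨ls, hl, hS', rfl⟩
  have : ls = [] := List.length_eq_zero_iff.1 (by omega)
  subst this
  exact absurd hS'.symm hS

theorem Fl_two {S : Multiset α} (hS : S ≠ 0) : Fl F 2 S = LL F S := by
  refine le_antisymm (Submodule.span_le.2 ?_) (LL_le_Fl S)
  rintro v ⟨ls, hl, hS', rfl⟩
  match ls, hl with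
  | [], _ => exact absurd hS'.symm hS
  | [l], _ =>
    subst hS'
    simpa [pl, mz] using lw_mem_LL (F := F) l

/-- `e` maps the filtration down, in the middle range. -/
theorem eul_mid {S : Multiset α} (hS : S ≠ 0) (r : ℕ) (h1 : 1 < r) (h2 : r < p) (v : T F α)
    (hv : v ∈ Fl F (r + 1) S) : eul F α p v ∈ Fl F r S := by
  induction hv using Submodule.span_induction with
  | mem x hx =>
    obtain ⟨ls, hl, rfl, rfl⟩ := hx
    have h0 : 0 < ls.length := by
      rcases Nat.eq_zero_or_pos ls.length with h | h
      · rw [List.length_eq_zero_iff] at h; subst h; exact absurd mz_nil hS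
      · exact h
    have h3 := Fl_mono (F := F) (show ls.length ≤ r by omega) _ (eul_pl p ls h0)
    rw [← sub_add_cancel (eul F α p (pl F ls)) ((if (p - 1) ∣ (p - 2 + ls.length) then (1 : F) else 0) • pl F ls)]
    refine Submodule.add_mem _ h3 ?_
    by_cases h4 : ls.length < r
    · exact Submodule.smul_mem _ _ (pl_mem h4 rfl)
    · have h5 : ls.length = r := by omega
      have h6 : ¬ (p - 1) ∣ (p - 2 + ls.length) := by
        have : p - 2 + ls.length = (p - 1) + (r - 1) := by omega
        rw [this, Nat.dvd_add_right (dvd_refl _)]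
        intro h7
        have := Nat.le_of_dvd (by omega) h7
        omega
      rw [if_neg h6, zero_smul]; exact Submodule.zero_mem _
  | zero => simp
  | add x y _ _ hx hy => rw [map_add]; exact Submodule.add_mem _ hx hy
  | smul c x _ hx => rw [map_smul]; exact Submodule.smul_mem _ _ hx

theorem eul_sub {S : Multiset α} (hS : S ≠ 0) (r : ℕ) (h1 : r = 1 ∨ r = p) (v : T F α)
    (hv : v ∈ Fl F (r + 1) S) : eul F α p v - v ∈ Fl F r S := by
  have hp2 := hp.out.two_le
  induction hv using Submodule.span_induction with
  | mem x hx =>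
    obtain ⟨ls, hl, rfl, rfl⟩ := hx
    have h0 : 0 < ls.length := by
      rcases Nat.eq_zero_or_pos ls.length with h | h
      · rw [List.length_eq_zero_iff] at h; subst h; exact absurd mz_nil hS
      · exact h
    have h3 := Fl_mono (F := F) (show ls.length ≤ r by omega) _ (eul_pl p ls h0)
    by_cases h4 : ls.length < r
    · have : eul F α p (pl F ls) - pl F ls = (eul F α p (pl F ls) - (if (p - 1) ∣ (p - 2 + ls.length) then (1 : F) else 0) • pl F ls) + ((if (p - 1) ∣ (p - 2 + ls.length) then (1 : F) else 0) - 1) • pl F ls := by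
        module
      rw [this]
      exact Submodule.add_mem _ h3 (Submodule.smul_mem _ _ (pl_mem h4 rfl))
    · have h5 : ls.length = r := by omega
      have h6 : (p - 1) ∣ (p - 2 + ls.length) := by
        rcases h1 with h1 | h1
        · exact ⟨1, by omega⟩
        · exact ⟨2, by omega⟩
      rwa [if_pos h6, one_smul] at h3
  | zero => simp
  | add x y _ _ hx hy =>
    rw [map_add, add_sub_add_comm]; exact Submodule.add_mem _ hx hy
  | smul c x _ hx => rw [map_smul, ← smul_sub]; exact Submodule.smul_mem _ _ hx

theorem eul_pow_mem {S : Multiset α} (hS : S ≠ 0) (n : ℕ) (h2 : n + 1 < p) (v : T F α)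
    (hv : v ∈ Fl F (n + 2) S) : ((eul F α p) ^ n) v ∈ Fl F 2 S := by
  induction n generalizing v with
  | zero => simpa using hv
  | succ n ih =>
    rw [pow_succ, Module.End.mul_apply]
    exact ih (by omega) _ (eul_mid p hS (n + 2) (by omega) (by omega) v hv)

end Eul

end LieEP

namespace LieEP

section Multilinear

variable {F : Type} [Field F] {α : Type}

/-- Multihomogeneous part of the tensor algebra. -/
noncomputable def Tm (F : Type) [Field F] {α : Type} (S : Multiset α) : Submodule F (T F α) :=
  Submodule.span F {v | ∃ l : List α, (l : Multiset α) = S ∧ v = wd F l}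

theorem wd_mem_Tm (l : List α) : wd F l ∈ Tm F (l : Multiset α) :=
  Submodule.subset_span ⟨l, rfl, rfl⟩

theorem Tm_mul {S S' : Multiset α} {a b : T F α} (ha : a ∈ Tm F S) (hb : b ∈ Tm F S') :
    a * b ∈ Tm F (S + S') := by
  have h := Submodule.mul_mem_mul ha hb
  rw [Tm, Tm, Submodule.span_mul_span] at h
  refine Submodule.span_le.2 ?_ h
  rintro _ ⟨_, ⟨l, rfl, rfl⟩, _, ⟨m, rfl, rfl⟩, rfl⟩
  change wd F l * wd F m ∈ _
  rw [← wd_append, Multiset.coe_add]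
  exact wd_mem_Tm _

theorem Tm_lie {S S' : Multiset α} {a b : T F α} (ha : a ∈ Tm F S) (hb : b ∈ Tm F S') :
    ⁅a, b⁆ ∈ Tm F (S + S') := by
  rw [Ring.lie_def]
  refine Submodule.sub_mem _ (Tm_mul ha hb) ?_
  rw [add_comm]; exact Tm_mul hb ha

theorem lw_mem_Tm (l : List α) : lw F l ∈ Tm F (l : Multiset α) := by
  induction l using List.reverseRecOn with
  | nil => simp [lw_nil]
  | append_singleton l z ih =>
    by_cases hl : l = []
    · subst hl
      exact wd_mem_Tm [z]
    · rw [lw_concat l hl, ← Multiset.coe_add]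
      exact Tm_lie ih (wd_mem_Tm [z])

theorem LL_le_Tm (S : Multiset α) : LL F S ≤ Tm F S := by
  refine Submodule.span_le.2 ?_
  rintro v ⟨l, rfl, rfl⟩
  exact lw_mem_Tm l

theorem pl_mem_Tm (ls : List (List α)) : pl F ls ∈ Tm F (mz ls) := by
  induction ls with
  | nil => exact wd_mem_Tm []
  | cons a l ih => rw [pl_cons, mz_cons]; exact Tm_mul (lw_mem_Tm a) ih

theorem Fl_le_Tm (r : ℕ) (S : Multiset α) : Fl F r S ≤ Tm F S := by
  refine Submodule.span_le.2 ?_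
  rintro v ⟨ls, _, rfl, rfl⟩
  exact pl_mem_Tm ls

theorem wd_eq_pl (l : List α) : wd F l = pl F (l.map fun x => [x]) := by
  rw [wd_eq_prod, pl, List.map_map]; rfl

theorem mz_singles (l : List α) : mz (l.map fun x => [x]) = (l : Multiset α) := by
  induction l with
  | nil => rfl
  | cons a l ih => rw [List.map_cons, mz_cons, ih]; rfl

theorem Tm_le_Fl (S : Multiset α) : Tm F S ≤ Fl F (Multiset.card S + 1) S := by
  refine Submodule.span_le.2 ?_
  rintro v ⟨l, rfl, rfl⟩
  rw [wd_eq_pl]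
  exact pl_mem (by simp) (mz_singles l)

/-- The augmentation. -/
noncomputable def aug (F : Type) [Field F] (α : Type) : T F α →ₐ[F] F := tlift fun _ => 1

theorem aug_wd (l : List α) : aug F α (wd F l) = 1 := by
  rw [aug, tlift_wd]
  simp

theorem aug_lw (l : List α) (h : 1 < l.length) : aug F α (lw F l) = 0 := by
  induction l using List.reverseRecOn with
  | nil => simp at h
  | append_singleton l z _ =>
    have hl : l ≠ [] := by rintro rfl; simp at h
    rw [lw_concat l hl, map_lie_ring, Ring.lie_def, mul_comm, sub_self]

theorem aug_pl (ls : List (List α)) (h : ls.length < Multiset.card (mz ls)) :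
    aug F α (pl F ls) = 0 := by
  induction ls with
  | nil => simp [mz_nil] at h
  | cons a l ih =>
    rw [pl_cons, map_mul]
    by_cases ha : 1 < a.length
    · rw [aug_lw a ha, zero_mul]
    · rw [ih, mul_zero]
      rw [mz_cons, Multiset.card_add, Multiset.coe_card] at h
      simp only [List.length_cons] at h
      omega

theorem aug_Fl (S : Multiset α) (v : T F α) (hv : v ∈ Fl F (Multiset.card S) S) :
    aug F α v = 0 := by
  suffices h : Fl F (Multiset.card S) S ≤ LinearMap.ker (aug F α).toLinearMap from h hv
  refine Submodule.span_le.2 ?_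
  rintro v ⟨ls, hl, rfl, rfl⟩
  exact aug_pl ls hl

theorem aug_tmap {β : Type} (f : α → β) (v : T F α) : aug F β (tmap f v) = aug F α v := by
  have : ((aug F β).comp (tmap f)) = aug F α := by
    apply alg_ext; intro x
    simp [tmap_ltr, aug, tlift_ltr]
  exact AlgHom.congr_fun this v

theorem sub_aug (w0 : List α) (v : T F α) (hv : v ∈ Tm F (w0 : Multiset α)) :
    v - aug F α v • wd F w0 ∈ Fl F w0.length (w0 : Multiset α) := by
  induction hv using Submodule.span_induction with
  | mem x hx =>
    obtain ⟨l, hl, rfl⟩ := hx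
    have hl' : l.Perm w0 := Multiset.coe_eq_coe.1 hl
    have := pl_perm (F := F) (hl'.map fun x => [x])
    rw [aug_wd, one_smul]
    rw [← wd_eq_pl, ← wd_eq_pl, mz_singles, List.length_map, hl'.length_eq, hl] at this
    exact this
  | zero => simp
  | add x y _ _ hx hy =>
    rw [map_add, add_smul, add_sub_add_comm]; exact Submodule.add_mem _ hx hy
  | smul c x _ hx =>
    rw [map_smul, smul_assoc, ← smul_sub]; exact Submodule.smul_mem _ _ hx

end Multilinear

section Perms

variable {F : Type} [Field F] {X : Type} [Fintype X] [DecidableEq X]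

theorem tmap_Tm_univ {Y : Type} [Fintype Y] (g : X ≃ Y) (v : T F X)
    (hv : v ∈ Tm F (Finset.univ.val : Multiset X)) :
    tmap g v ∈ Tm F (Finset.univ.val : Multiset Y) := by
  suffices h : Tm F (Finset.univ.val : Multiset X) ≤
    (Tm F (Finset.univ.val : Multiset Y)).comap (tmap g : T F X →ₐ[F] T F Y).toLinearMap from h hv
  refine Submodule.span_le.2 ?_
  rintro v ⟨l, hl, rfl⟩
  change tmap g (wd F l) ∈ Tm F (Finset.univ.val : Multiset Y)
  rw [tmap_wd]
  have : ((l.map g : List Y) : Multiset Y) = Finset.univ.val := by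
    rw [← Multiset.map_coe, hl, Multiset.map_univ_val_equiv]
  rw [← this]
  exact wd_mem_Tm _

theorem tmap_LL_univ {Y : Type} [Fintype Y] (g : X ≃ Y) (v : T F X)
    (hv : v ∈ LL F (Finset.univ.val : Multiset X)) :
    tmap g v ∈ LL F (Finset.univ.val : Multiset Y) := by
  suffices h : LL F (Finset.univ.val : Multiset X) ≤
    (LL F (Finset.univ.val : Multiset Y)).comap (tmap g : T F X →ₐ[F] T F Y).toLinearMap from h hv
  refine Submodule.span_le.2 ?_
  rintro v ⟨l, hl, rfl⟩
  change tmap g (lw F l) ∈ LL F (Finset.univ.val : Multiset Y)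
  rw [tmap_lw]
  have : ((l.map g : List Y) : Multiset Y) = Finset.univ.val := by
    rw [← Multiset.map_coe, hl, Multiset.map_univ_val_equiv]
  rw [← this]
  exact lw_mem_LL _

/-- The multilinear part of the free Lie algebra as representation. -/
noncomputable def lieR (F X : Type) [Field F] [Fintype X] [DecidableEq X] :
    Representation F (Equiv.Perm X) (LL F (Finset.univ.val : Multiset X)) :=
  (tRep F X).subrepresentation _ fun g v hv => tmap_LL_univ g v hv

theorem lieR_apply (g : Equiv.Perm X) (v : LL F (Finset.univ.val : Multiset X)) :
    (lieR F X g v : T F X) = tmap g (v : T F X) := rfl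

theorem exists_perm {l w : List X} (hl : (l : Multiset X) = Finset.univ.val)
    (hw : (w : Multiset X) = Finset.univ.val) : ∃ g : Equiv.Perm X, w.map g = l := by
  have hln : l.Nodup := by
    rw [← Multiset.coe_nodup, hl]; exact Finset.univ.nodup
  have hwn : w.Nodup := by
    rw [← Multiset.coe_nodup, hw]; exact Finset.univ.nodup
  have hlm : ∀ x, x ∈ l := fun x => by
    rw [← Multiset.mem_coe, hl]; exact Finset.mem_univ x
  have hwm : ∀ x, x ∈ w := fun x => by
    rw [← Multiset.mem_coe, hw]; exact Finset.mem_univ x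
  have hlen : w.length = l.length := by
    rw [← Multiset.coe_card, ← Multiset.coe_card, hl, hw]
  refine ⟨(hwn.getEquivOfForallMemList w hwm).symm.trans
    ((finCongr hlen).trans (hln.getEquivOfForallMemList l hlm)), ?_⟩
  refine List.ext_getElem (by simpa using hlen) ?_
  intro i h1 h2
  have hi : i < w.length := by simpa using h1
  have : (hwn.getEquivOfForallMemList w hwm).symm w[i] = ⟨i, hi⟩ := by
    rw [Equiv.symm_apply_eq]; rfl
  simp [this]

theorem map_perm_inj {l : List X} (hl : (l : Multiset X) = Finset.univ.val)
    {g h : X → X} (e : l.map g = l.map h) : g = h := by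
  funext x
  have hx : x ∈ l := by
    rw [← Multiset.mem_coe, hl]; exact Finset.mem_univ x
  exact List.map_inj_left.1 e x hx

/-- Projection to a single word. -/
noncomputable def thet (F : Type) [Field F] {X : Type} [DecidableEq X] (w0 : List X) :
    T F X →ₗ[F] T F X :=
  wlift fun l => if l = w0 then wd F w0 else 0

theorem thet_wd (w0 l : List X) : thet F w0 (wd F l) = if l = w0 then wd F w0 else 0 :=
  wlift_wd _ _

theorem thet_mem (w0 : List X) (v : T F X) : thet F w0 v ∈ Tm F (w0 : Multiset X) := by
  induction v using T_induction with
  | h0 => simp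
  | hadd x y hx hy => rw [map_add]; exact Submodule.add_mem _ hx hy
  | hw c l =>
    rw [map_smul, thet_wd]
    refine Submodule.smul_mem _ _ ?_
    split_ifs
    · exact wd_mem_Tm _
    · exact Submodule.zero_mem _

theorem thet_trace {w0 : List X} (hw : (w0 : Multiset X) = Finset.univ.val) (v : T F X)
    (hv : v ∈ Tm F (Finset.univ.val : Multiset X)) :
    ∑ g : Equiv.Perm X, tmap g (thet F w0 (tmap (g⁻¹ : Equiv.Perm X) v)) = v := by
  induction hv using Submodule.span_induction with
  | mem x hx =>
    obtain ⟨l, hl, rfl⟩ := hx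
    obtain ⟨g0, hg0⟩ := exists_perm hl hw
    rw [Finset.sum_eq_single g0]
    · have : l.map (g0⁻¹ : Equiv.Perm X) = w0 := by
        rw [← hg0, List.map_map]
        have : ((g0⁻¹ : Equiv.Perm X) : X → X) ∘ g0 = id := by ext x; simp
        rw [this, List.map_id]
      rw [tmap_wd, thet_wd, if_pos this, tmap_wd, hg0]
    · intro g _ hg
      rw [tmap_wd, thet_wd, if_neg, map_zero]
      intro h
      apply hg
      have : w0.map g = l := by
        rw [← h, List.map_map]
        have : (g : X → X) ∘ (g⁻¹ : Equiv.Perm X) = id := by ext x; simp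
        rw [this, List.map_id]
      exact DFunLike.coe_injective (map_perm_inj hw (this.trans hg0.symm))
    · simp
  | zero => simp
  | add x y _ _ hx hy => simp only [map_add, Finset.sum_add_distrib, hx, hy]
  | smul c x _ hx => simp only [map_smul, ← Finset.smul_sum, hx]

end Perms

end LieEP

namespace LieEP

section LiePrime

variable {F : Type} [Field F] {X : Type} [Fintype X] [DecidableEq X]

theorem finite_LL : FiniteDimensional F (LL F (Finset.univ.val : Multiset X)) := by
  have : {v | ∃ l : List X, (l : Multiset X) = Finset.univ.val ∧ v = lw F l} ⊆
      Set.range fun g : Equiv.Perm X => lw F ((Finset.univ : Finset X).toList.map g) := by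
    rintro v ⟨l, hl, rfl⟩
    obtain ⟨g, hg⟩ := exists_perm hl (Finset.coe_toList (Finset.univ : Finset X))
    exact ⟨g, by simp only [hg]⟩
  exact FiniteDimensional.span_of_finite F ((Set.finite_range _).subset this)

theorem ep_lieR (p : ℕ) [hp : Fact p.Prime] [CharP F p] (hX : Fintype.card X = p) :
    EP (lieR F X) := by
  have hp2 := hp.out.two_le
  let S : Multiset X := Finset.univ.val
  have hcard : Multiset.card S = p := by rw [← hX]; rfl
  have hS : S ≠ 0 := by
    intro h
    rw [h, Multiset.card_zero] at hcard
    omega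
  let w0 : List X := (Finset.univ : Finset X).toList
  have hw0 : (w0 : Multiset X) = S := Finset.coe_toList _
  have hlen : w0.length = p := by rw [← hcard, ← hw0]; rfl
  let E : Module.End F (T F X) := eul F X p
  let u : Module.End F (T F X) := E - 1
  let f : Module.End F (T F X) := E ^ (p - 2)
  let q : Module.End F (T F X) := (1 + 2 * u) * f
  have cEu : Commute E u := (Commute.refl E).sub_right (Commute.one_right E)
  have cfu : Commute f u := cEu.pow_left _
  have u_apply : ∀ v, u v = E v - v := fun v => rfl
  have TmFl : ∀ v ∈ Tm F S, v ∈ Fl F (p + 1) S := by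
    intro v hv
    have := Tm_le_Fl S hv
    rwa [hcard] at this
  have uTm : ∀ v ∈ Tm F S, u v ∈ Fl F p S := fun v hv =>
    eul_sub p hS p (Or.inr rfl) v (TmFl v hv)
  have uFl2 : ∀ v ∈ Fl F 2 S, u v = 0 := by
    intro v hv
    have := eul_sub p hS 1 (Or.inl rfl) v hv
    rw [Fl_one hS] at this
    exact this
  have fFl : ∀ v ∈ Fl F p S, f v ∈ Fl F 2 S := by
    intro v hv
    refine eul_pow_mem p hS (p - 2) (by omega) v ?_
    have : p - 2 + 2 = p := by omega
    rwa [this]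
  have E_Tm : ∀ v ∈ Tm F S, E v ∈ Tm F S := by
    intro v hv
    have h1 := Submodule.add_mem _ (Fl_le_Tm _ _ (uTm v hv)) hv
    rwa [u_apply, sub_add_cancel] at h1
  have u_Tm : ∀ v ∈ Tm F S, u v ∈ Tm F S := fun v hv => Fl_le_Tm _ _ (uTm v hv)
  have f_Tm : ∀ v ∈ Tm F S, f v ∈ Tm F S := by
    suffices h : ∀ n : ℕ, ∀ v ∈ Tm F S, (E ^ n) v ∈ Tm F S from h _
    intro n
    induction n with
    | zero => intro v hv; simpa using hv
    | succ n ih =>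
      intro v hv
      rw [pow_succ, Module.End.mul_apply]
      exact ih _ (E_Tm v hv)
  have q_apply : ∀ v, q v = f v + (2 : F) • u (f v) := by
    intro v
    have : (2 : Module.End F (T F X)) = 1 + 1 := one_add_one_eq_two.symm
    change ((1 + 2 * u) * f) v = _
    rw [this]
    simp only [Module.End.mul_apply, LinearMap.add_apply, Module.End.one_apply]
    module
  have uuf : ∀ v ∈ Tm F S, u (u (f v)) = 0 := by
    intro v hv
    have h1 : u (f v) = f (u v) := LinearMap.congr_fun cfu.eq.symm v
    rw [h1]
    exact uFl2 _ (fFl _ (uTm v hv))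
  let P : Submodule F (T F X) := Tm F S ⊓ LinearMap.ker (u * u)
  have P_uu : ∀ v ∈ P, u (u v) = 0 := fun v hv => hv.2
  have q_mem : ∀ v ∈ Tm F S, q v ∈ P := by
    intro v hv
    rw [q_apply]
    refine ⟨Submodule.add_mem _ (f_Tm v hv) (Submodule.smul_mem _ _ (u_Tm _ (f_Tm v hv))), ?_⟩
    rw [SetLike.mem_coe, LinearMap.mem_ker, Module.End.mul_apply, map_add, map_add, map_smul, map_smul, uuf v hv,
      map_zero, smul_zero, add_zero]
  have powE : ∀ n : ℕ, ∀ v, u (u v) = 0 → (E ^ n) v = v + (n : F) • u v := by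
    intro n v hv
    induction n with
    | zero => simp
    | succ n ih =>
      have hE : ∀ w, E w = w + u w := fun w => by rw [u_apply]; abel
      rw [pow_succ', Module.End.mul_apply, ih, map_add, map_smul, hE v, hE (u v), hv]
      push_cast
      module
  have cast2 : ((p - 2 : ℕ) : F) = -2 := by
    rw [Nat.cast_sub hp2, CharP.cast_eq_zero F p]; simp
  have f_P : ∀ v, u (u v) = 0 → f v = v - (2 : F) • u v := by
    intro v hv
    change (E ^ (p - 2)) v = _
    rw [powE _ v hv, cast2]
    module
  have q_P : ∀ v ∈ P, q v = v := by
    intro v hv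
    have h := P_uu v hv
    rw [q_apply, f_P v h, map_sub, map_smul, h]
    module
  have cE : ∀ g : Equiv.Perm X, Commute (tRep F X g) E := by
    intro g
    refine LinearMap.ext fun v => ?_
    exact (eul_tmap p g v).symm
  have cu : ∀ g : Equiv.Perm X, Commute (tRep F X g) u := fun g =>
    (cE g).sub_right (Commute.one_right _)
  have cq : ∀ g : Equiv.Perm X, Commute (tRep F X g) q := fun g =>
    ((Commute.one_right _).add_right ((Commute.ofNat_right _ 2).mul_right (cu g))).mul_right
      ((cE g).pow_right _)
  have P_stable : ∀ g : Equiv.Perm X, P ≤ P.comap (tRep F X g) := by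
    intro g v hv
    refine ⟨tmap_Tm_univ g v hv.1, ?_⟩
    have h : (u * u) (tRep F X g v) = tRep F X g ((u * u) v) :=
      LinearMap.congr_fun ((cu g).mul_right (cu g)).eq.symm v
    have h2 : (u * u) v = 0 := hv.2
    rw [SetLike.mem_coe, LinearMap.mem_ker, h, h2, map_zero]
  let ρP : Representation F (Equiv.Perm X) P := (tRep F X).subrepresentation P P_stable
  have hP : HP ρP := by
    let θ : P →ₗ[F] P := LinearMap.codRestrict P (q ∘ₗ thet F w0 ∘ₗ P.subtype) (fun v => by
      refine q_mem _ ?_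
      rw [← hw0]
      exact thet_mem w0 _)
    refine ⟨θ, fun v => ?_⟩
    apply Subtype.ext
    have h1 := congrArg q (thet_trace hw0 v.1 v.2.1)
    rw [q_P v.1 v.2, map_sum] at h1
    refine Eq.trans ?_ h1
    rw [AddSubmonoidClass.coe_finsetSum]
    refine Finset.sum_congr rfl fun g _ => ?_
    exact LinearMap.congr_fun (cq g).eq (thet F w0 (tmap (g⁻¹ : Equiv.Perm X) v.1))
  have Lie_P : ∀ v ∈ LL F S, v ∈ P := by
    intro v hv
    refine ⟨LL_le_Tm S hv, ?_⟩
    rw [SetLike.mem_coe, LinearMap.mem_ker, Module.End.mul_apply, uFl2 v (LL_le_Fl S hv), map_zero]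
  have aug_u : ∀ v ∈ Tm F S, aug F X (u v) = 0 := by
    intro v hv
    refine aug_Fl S _ ?_
    rw [hcard]; exact uTm v hv
  have aug_E : ∀ v ∈ Tm F S, aug F X (E v) = aug F X v := by
    intro v hv
    have := aug_u v hv
    rw [u_apply, map_sub, sub_eq_zero] at this
    exact this
  have aug_f : ∀ v ∈ Tm F S, aug F X (f v) = aug F X v := by
    suffices h : ∀ n : ℕ, ∀ v ∈ Tm F S, aug F X ((E ^ n) v) = aug F X v from h _
    intro n
    induction n with
    | zero => intro v hv; simp
    | succ n ih =>
      intro v hv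
      rw [pow_succ, Module.End.mul_apply, ih _ (E_Tm v hv), aug_E v hv]
  have w0_Tm : wd F w0 ∈ Tm F S := by rw [← hw0]; exact wd_mem_Tm w0
  have aug_q : aug F X (q (wd F w0)) = 1 := by
    rw [q_apply, map_add, map_smul, aug_u _ (f_Tm _ w0_Tm), aug_f _ w0_Tm, aug_wd]
    simp
  refine ep_of_exact (ρP := ρP) (ρL := (1 : Representation F (Equiv.Perm X) F))
    (Submodule.inclusion Lie_P) ((aug F X).toLinearMap ∘ₗ P.subtype) ?_ ?_ ?_ ?_ ?_ hP ?_
  · intro g v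
    exact Subtype.ext rfl
  · intro g v
    exact aug_tmap g v.1
  · exact Submodule.inclusion_injective Lie_P
  · intro c
    refine ⟨c • ⟨q (wd F w0), q_mem _ w0_Tm⟩, ?_⟩
    rw [map_smul]
    change c • aug F X (q (wd F w0)) = c
    rw [aug_q, smul_eq_mul, mul_one]
  · rintro ⟨v, hv⟩
    constructor
    · intro h
      have h1 : aug F X v = 0 := h
      have h2 := sub_aug w0 v (by rw [hw0]; exact hv.1)
      rw [h1, zero_smul, sub_zero, hw0, hlen] at h2
      have h3 := fFl v h2
      have h4 := P_uu v hv
      have h5 := uFl2 _ h3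
      rw [f_P v h4] at h3
      rw [f_P v h4, map_sub, map_smul, h4, smul_zero, sub_zero] at h5
      rw [h5, smul_zero, sub_zero, Fl_two hS] at h3
      exact ⟨⟨v, h3⟩, rfl⟩
    · rintro ⟨⟨w, hw⟩, hwv⟩
      have h6 : w = v := congrArg Subtype.val hwv
      subst h6
      refine aug_Fl S _ ?_
      rw [hcard]
      exact Fl_mono hp2 S (LL_le_Fl S hw)
  · refine IsPerm.pp ⟨Unit, Module.Basis.singleton Unit F, fun g x => ⟨x, ?_⟩⟩
    simp

end LiePrime

end LieEP

namespace LieEP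

section Elim

variable {F : Type} [Field F] {X Y : Type}

/-- The letters sequence underlying an elimination letter. -/
def exl (a : X × List Y) : List (X ⊕ Y) := Sum.inl a.1 :: a.2.map Sum.inr

/-- The elimination map. -/
noncomputable def phi (F X Y : Type) [Field F] : T F (X × List Y) →ₐ[F] T F (X ⊕ Y) :=
  tlift fun a => lw F (exl a)

theorem phi_ltr (a : X × List Y) : phi F X Y (ltr F a) = lw F (exl a) := tlift_ltr _ _

/-- Derivation on words. -/
noncomputable def dW (F : Type) [Field F] {X Y : Type} (y : Y) :
    List (X × List Y) → T F (X × List Y)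
  | [] => 0
  | a :: l => ltr F (a.1, a.2 ++ [y]) * wd F l + ltr F a * dW F y l

theorem dW_concat (y : Y) (l : List (X × List Y)) (a : X × List Y) :
    dW F y (l ++ [a]) = dW F y l * ltr F a + wd F l * ltr F (a.1, a.2 ++ [y]) := by
  induction l with
  | nil => simp [dW, wd_nil]
  | cons b l ih =>
    simp only [List.cons_append, dW, ih, wd_append, wd_cons]
    rw [wd_nil]
    noncomm_ring

/-- Derivation. -/
noncomputable def dD (F X : Type) {Y : Type} [Field F] (y : Y) : Module.End F (T F (X × List Y)) :=
  wlift (dW F y)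

theorem dD_mul_ltr (y : Y) (v : T F (X × List Y)) (a : X × List Y) :
    dD F X y (v * ltr F a) = dD F X y v * ltr F a + v * ltr F (a.1, a.2 ++ [y]) := by
  induction v using T_induction with
  | h0 => simp
  | hadd x y hx hy => simp only [add_mul, map_add, hx, hy]; abel
  | hw c l =>
    have h : dD F X y (wd F l * ltr F a) =
        dD F X y (wd F l) * ltr F a + wd F l * ltr F (a.1, a.2 ++ [y]) := by
      rw [ltr, ← wd_append, dD, wlift_wd, wlift_wd]
      exact dW_concat y l a
    rw [smul_mul_assoc, map_smul, h, map_smul, smul_add, smul_mul_assoc, smul_mul_assoc]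

/-- The right action used to invert `phi`. -/
noncomputable def rR (F X Y : Type) [Field F] :
    T F (X ⊕ Y) →ₐ[F] (Module.End F (T F (X × List Y)))ᵐᵒᵖ :=
  tlift (Sum.elim (fun x => MulOpposite.op (LinearMap.mulRight F (ltr F (x, []))))
    fun y => MulOpposite.op (dD F X y))

theorem rR_lw (x : X) (w : List Y) :
    rR F X Y (lw F (exl (x, w))) = MulOpposite.op (LinearMap.mulRight F (ltr F (x, w))) := by
  induction w using List.reverseRecOn with
  | nil => exact tlift_ltr _ _
  | append_singleton w y ih =>
    have : exl (x, w ++ [y]) = exl (x, w) ++ [Sum.inr y] := by simp [exl]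
    rw [this, lw_concat _ (by simp [exl]), map_lie_ring, ih]
    have h : rR F X Y (ltr F (Sum.inr y)) = MulOpposite.op (dD F X y) := tlift_ltr _ _
    rw [h, Ring.lie_def, ← MulOpposite.op_mul, ← MulOpposite.op_mul, ← MulOpposite.op_sub]
    congr 1
    refine LinearMap.ext fun v => ?_
    simp [dD_mul_ltr]

/-- Left inverse to `phi`. -/
noncomputable def eps (F X Y : Type) [Field F] : T F (X ⊕ Y) →ₗ[F] T F (X × List Y) :=
  (LinearMap.applyₗ (1 : T F (X × List Y))) ∘ₗ
    (MulOpposite.opLinearEquiv F).symm.toLinearMap ∘ₗ (rR F X Y).toLinearMap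

theorem eps_phi (b : T F (X × List Y)) : eps F X Y (phi F X Y b) = b := by
  have : (eps F X Y) ∘ₗ (phi F X Y).toLinearMap = LinearMap.id := by
    refine lin_ext fun l => ?_
    change (rR F X Y (phi F X Y (wd F l))).unop 1 = wd F l
    induction l using List.reverseRecOn with
    | nil => simp [wd_nil]
    | append_singleton l a ih =>
      rw [wd_append, map_mul, map_mul, MulOpposite.unop_mul, Module.End.mul_apply, ih]
      change (rR F X Y (phi F X Y (ltr F a))).unop _ = _ * ltr F a
      rw [phi_ltr, rR_lw]
      simp
  exact LinearMap.congr_fun this b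

/-- Decoding the labels. -/
def lkp [DecidableEq X] (l : List (X × List Y)) : X → List Y := fun x => (l.lookup x).getD []

theorem lookup_map [DecidableEq X] (w : X → List Y) (l : List X) (x : X) (hx : x ∈ l) :
    (l.map fun x => (x, w x)).lookup x = some (w x) := by
  induction l with
  | nil => simp at hx
  | cons a l ih =>
    rw [List.map_cons, List.lookup_cons]
    by_cases h : x = a
    · subst h; simp
    · have : x ∈ l := by simpa [h] using hx
      have hb : (x == a) = false := by simpa using h
      rw [hb]
      exact ih this

/-- Decoding map. -/
noncomputable def kap (F X Y : Type) [Field F] [DecidableEq X] :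
    T F (X × List Y) →ₗ[F] ((X → List Y) →₀ T F X) :=
  wlift fun l => Finsupp.single (lkp l) (wd F (l.map Prod.fst))

theorem kap_tmap [Fintype X] [DecidableEq X] (w : X → List Y) (u : T F X)
    (hu : u ∈ Tm F (Finset.univ.val : Multiset X)) :
    kap F X Y (tmap (fun x => (x, w x)) u) = Finsupp.single w u := by
  induction hu using Submodule.span_induction with
  | mem x hx =>
    obtain ⟨l, hl, rfl⟩ := hx
    have hlm : ∀ x, x ∈ l := fun x => by
      rw [← Multiset.mem_coe, hl]; exact Finset.mem_univ x
    rw [tmap_wd, kap, wlift_wd, List.map_map]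
    have h1 : lkp (l.map fun x => (x, w x)) = w := by
      funext x
      rw [lkp, lookup_map w l x (hlm x)]; rfl
    have h2 : (Prod.fst ∘ fun x => (x, w x)) = (id : X → X) := rfl
    rw [h1, h2, List.map_id]
  | zero => simp
  | add x y _ _ hx hy => rw [map_add, map_add, hx, hy, Finsupp.single_add]
  | smul c x _ hx => rw [map_smul, map_smul, hx, Finsupp.smul_single]

/-- Total content. -/
def tot (ls : List (X × List Y)) : Multiset (X ⊕ Y) := ((ls.map exl).flatten : List (X ⊕ Y))

theorem tot_nil : tot ([] : List (X × List Y)) = 0 := rfl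

theorem tot_append (l m : List (X × List Y)) : tot (l ++ m) = tot l + tot m := by
  simp [tot]

theorem tot_singleton (a : X × List Y) : tot [a] = (exl a : Multiset (X ⊕ Y)) := by
  simp [tot]

theorem phi_lw_concat (ls : List (X × List Y)) (h : ls ≠ []) (a : X × List Y) :
    phi F X Y (lw F (ls ++ [a])) = ⁅phi F X Y (lw F ls), lw F (exl a)⁆ := by
  rw [lw_concat _ h, map_lie_ring, phi_ltr]

theorem phi_lw_mem (ls : List (X × List Y)) : phi F X Y (lw F ls) ∈ LL F (tot ls) := by
  induction ls using List.reverseRecOn with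
  | nil => simp [lw_nil]
  | append_singleton l a ih =>
    by_cases hl : l = []
    · subst hl
      rw [List.nil_append, lw_singleton, phi_ltr, tot_singleton]
      exact lw_mem_LL _
    · rw [phi_lw_concat l hl, tot_append, tot_singleton]
      exact lie_lnbs_mem (fun S => LL F S) (ltr F) LL_step (exl a) (tot l) _ ih

/-- The image of the free Lie algebra on the elimination letters. -/
noncomputable def II (F X Y : Type) [Field F] (S : Multiset (X ⊕ Y)) :
    Submodule F (T F (X ⊕ Y)) :=
  Submodule.span F {v | ∃ ls : List (X × List Y), tot ls = S ∧ v = phi F X Y (lw F ls)}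

theorem phi_lw_mem_II (ls : List (X × List Y)) : phi F X Y (lw F ls) ∈ II F X Y (tot ls) :=
  Submodule.subset_span ⟨ls, rfl, rfl⟩

/-- Extending bracket membership from generators. -/
theorem lie_span_mem {B : Type} [Ring B] [Algebra F B] {s : Set B} (J : Submodule F B) (z : B)
    (h : ∀ v ∈ s, ⁅v, z⁆ ∈ J) (v : B) (hv : v ∈ Submodule.span F s) : ⁅v, z⁆ ∈ J := by
  induction hv using Submodule.span_induction with
  | mem x hx => exact h x hx
  | zero => simp [Ring.lie_def]
  | add x y _ _ hx hy =>
    have : ⁅x + y, z⁆ = ⁅x, z⁆ + ⁅y, z⁆ := by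
      simp only [Ring.lie_def]; noncomm_ring
    rw [this]; exact Submodule.add_mem _ hx hy
  | smul c x _ hx =>
    have : ⁅c • x, z⁆ = c • ⁅x, z⁆ := by simp [Ring.lie_def, smul_sub]
    rw [this]; exact Submodule.smul_mem _ _ hx

theorem II_lie_exl (S : Multiset (X ⊕ Y)) (v : T F (X ⊕ Y)) (hv : v ∈ II F X Y S)
    (a : X × List Y) : ⁅v, lw F (exl a)⁆ ∈ II F X Y (S + (exl a : Multiset (X ⊕ Y))) := by
  refine lie_span_mem _ _ ?_ v hv
  rintro _ ⟨ls, rfl, rfl⟩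
  by_cases hl : ls = []
  · subst hl
    simp [lw_nil, Ring.lie_def]
  · rw [← phi_lw_concat ls hl, ← tot_singleton, ← tot_append]
    exact phi_lw_mem_II _

theorem II_lie_inr (y : Y) (S : Multiset (X ⊕ Y)) (v : T F (X ⊕ Y)) (hv : v ∈ II F X Y S) :
    ⁅v, ltr F (Sum.inr y)⁆ ∈ II F X Y (S + {Sum.inr y}) := by
  refine lie_span_mem _ _ ?_ v hv
  rintro _ ⟨ls, rfl, rfl⟩
  clear hv v
  have hex : ∀ a : X × List Y, ⁅lw F (exl a), ltr F (Sum.inr y)⁆ = lw F (exl (a.1, a.2 ++ [y])) := by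
    intro a
    have : exl (a.1, a.2 ++ [y]) = exl a ++ [Sum.inr y] := by simp [exl]
    rw [this, lw_concat _ (by simp [exl])]
  have hct : ∀ a : X × List Y, (exl (a.1, a.2 ++ [y]) : Multiset (X ⊕ Y)) =
      (exl a : Multiset (X ⊕ Y)) + {Sum.inr y} := by
    intro a
    have : exl (a.1, a.2 ++ [y]) = exl a ++ [Sum.inr y] := by simp [exl]
    rw [this, ← Multiset.coe_add]; rfl
  induction ls using List.reverseRecOn with
  | nil => simp [lw_nil, Ring.lie_def]
  | append_singleton l a ih =>
    by_cases hl : l = []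
    · subst hl
      rw [List.nil_append, lw_singleton, phi_ltr, hex, tot_singleton, ← hct, ← phi_ltr,
        ← tot_singleton]
      exact phi_lw_mem_II [_]
    · rw [phi_lw_concat l hl]
      have e : ⁅⁅phi F X Y (lw F l), lw F (exl a)⁆, ltr F (Sum.inr y : X ⊕ Y)⁆ =
          ⁅⁅phi F X Y (lw F l), ltr F (Sum.inr y : X ⊕ Y)⁆, lw F (exl a)⁆ +
          ⁅phi F X Y (lw F l), ⁅lw F (exl a), ltr F (Sum.inr y : X ⊕ Y)⁆⁆ := by
        simp only [Ring.lie_def]; noncomm_ring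
      rw [e, hex, tot_append, tot_singleton]
      refine Submodule.add_mem _ ?_ ?_
      · have := II_lie_exl _ _ ih a
        rwa [add_right_comm] at this
      · have := II_lie_exl _ _ (phi_lw_mem_II (F := F) l) (a.1, a.2 ++ [y])
        rwa [hct, ← add_assoc] at this

theorem II_step (S : Multiset (X ⊕ Y)) (v : T F (X ⊕ Y)) (hv : v ∈ II F X Y S) (z : X ⊕ Y) :
    ⁅v, ltr F z⁆ ∈ II F X Y (S + {z}) := by
  cases z with
  | inl x => exact II_lie_exl S v hv (x, [])
  | inr y => exact II_lie_inr y S v hv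

theorem ltr_inl_mem (x : X) : ltr F (Sum.inl x : X ⊕ Y) ∈ II F X Y {Sum.inl x} := by
  have := phi_lw_mem_II (F := F) [((x, []) : X × List Y)]
  rwa [tot_singleton, lw_singleton, phi_ltr] at this

theorem lw_mem_II (l : List (X ⊕ Y)) (h : ∃ x, Sum.inl x ∈ l) :
    lw F l ∈ II F X Y (l : Multiset (X ⊕ Y)) := by
  induction l using List.reverseRecOn with
  | nil => simp at h
  | append_singleton l z ih =>
    by_cases hl : l = []
    · subst hl
      obtain ⟨x, hx⟩ := h
      have : z = Sum.inl x := by simpa [eq_comm] using hx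
      subst this
      exact ltr_inl_mem x
    · rw [lw_concat l hl, ← Multiset.coe_add]
      by_cases h' : ∃ x, Sum.inl x ∈ l
      · exact II_step _ _ (ih h') z
      · obtain ⟨x, hx⟩ := h
        have : z = Sum.inl x := by
          rw [List.mem_append] at hx
          rcases hx with hx | hx
          · exact absurd ⟨x, hx⟩ h'
          · simpa [eq_comm] using hx
        subst this
        have e : ⁅lw F l, ltr F (Sum.inl x : X ⊕ Y)⁆ = -⁅ltr F (Sum.inl x : X ⊕ Y), lw F l⁆ := by
          simp only [Ring.lie_def]; noncomm_ring
        rw [e, add_comm]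
        exact Submodule.neg_mem _
          (lie_lnbs_mem (fun S => II F X Y S) (ltr F) II_step l _ _ (ltr_inl_mem x))

theorem LL_le_II (S : Multiset (X ⊕ Y)) (h : ∃ x, Sum.inl x ∈ S) : LL F S ≤ II F X Y S := by
  refine Submodule.span_le.2 ?_
  rintro v ⟨l, rfl, rfl⟩
  exact lw_mem_II l (by simpa using h)

end Elim

end LieEP

namespace LieEP

section ElimRep

open TensorProduct

variable {F : Type} [Field F] {X Y : Type}

theorem EP.comp_hom {G H V : Type} [Group G] [Group H] [AddCommGroup V] [Module F V] (f : H →* G)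
    {ρ : Representation F G V} (h : EP ρ) : EP (ρ.comp f : Representation F H V) := by
  have h' := PP.comp_hom f h
  have e : (MonoidHom.comp (ρ.tprod ρ.dual) f : Representation F H _) =
      Representation.tprod (MonoidHom.comp ρ f : Representation F H V)
        (Representation.dual (MonoidHom.comp ρ f : Representation F H V)) := by
    refine MonoidHom.ext fun g => ?_
    simp [Representation.tprod_apply, Representation.dual_apply]
  rw [e] at h'
  exact h'

theorem tot_eq (ls : List (X × List Y)) :
    tot ls = Multiset.disjSum ((ls.map Prod.fst : List X) : Multiset X)
      (((ls.map Prod.snd).flatten : List Y) : Multiset Y) := by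
  induction ls with
  | nil => rfl
  | cons a l ih =>
    have : tot (a :: l) = tot [a] + tot l := tot_append [a] l
    rw [this, ih, tot_singleton]
    simp only [Multiset.disjSum, List.map_cons, List.flatten_cons, ← Multiset.coe_add, exl,
      Multiset.map_add, ← Multiset.cons_coe, Multiset.map_cons, Multiset.cons_add,
      ← Multiset.map_coe]
    rw [add_left_comm]

theorem filterMap_none {Z : Type} (s : Multiset X) :
    Multiset.filterMap (fun _ => (none : Option Z)) s = 0 := by
  induction s using Multiset.induction with
  | empty => rfl
  | cons a s ih => rw [Multiset.filterMap_cons_none _ _ rfl, ih]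

theorem disjSum_inj {s s' : Multiset X} {t t' : Multiset Y}
    (h : s.disjSum t = s'.disjSum t') : s = s' ∧ t = t' := by
  classical
  have h1 : ∀ (s : Multiset X) (t : Multiset Y),
      (s.disjSum t).filterMap Sum.getLeft? = s := by
    intro s t
    simp [Multiset.disjSum, Multiset.filterMap_add, Multiset.filterMap_map, Function.comp_def,
      filterMap_none]
  have h2 : ∀ (s : Multiset X) (t : Multiset Y),
      (s.disjSum t).filterMap Sum.getRight? = t := by
    intro s t
    simp [Multiset.disjSum, Multiset.filterMap_add, Multiset.filterMap_map, Function.comp_def,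
      filterMap_none]
  exact ⟨by rw [← h1 s t, h, h1], by rw [← h2 s t, h, h2]⟩

theorem univ_sum_val [Fintype X] [Fintype Y] :
    (Finset.univ : Finset (X ⊕ Y)).val =
      Multiset.disjSum (Finset.univ : Finset X).val (Finset.univ : Finset Y).val := rfl

theorem exists_label (ls : List (X × List Y)) (h : (ls.map Prod.fst).Nodup) :
    ∃ w : X → List Y, ls = (ls.map Prod.fst).map fun x => (x, w x) := by
  classical
  induction ls with
  | nil => exact ⟨fun _ => [], rfl⟩
  | cons a l ih =>
    rw [List.map_cons, List.nodup_cons] at h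
    obtain ⟨w, hw⟩ := ih h.2
    refine ⟨Function.update w a.1 a.2, ?_⟩
    rw [List.map_cons, List.map_cons]
    congr 1
    · simp
    · conv_lhs => rw [hw]
      refine List.map_congr_left fun x hx => ?_
      have : x ≠ a.1 := by rintro rfl; exact h.1 hx
      simp [this]

theorem coe_flatten (ls : List (List Y)) :
    ((ls.flatten : List Y) : Multiset Y) = (ls.map (Multiset.ofList : List Y → Multiset Y)).sum := by
  induction ls with
  | nil => rfl
  | cons a l ih => rw [List.flatten_cons, ← Multiset.coe_add, ih, List.map_cons, List.sum_cons]

theorem flatten_label [Fintype X] (l : List X) (hl : (l : Multiset X) = Finset.univ.val)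
    (w : X → List Y) :
    ((((l.map fun x => (x, w x)).map Prod.snd).flatten : List Y) : Multiset Y) =
      ∑ x, (w x : Multiset Y) := by
  rw [coe_flatten, List.map_map, List.map_map, Finset.sum, ← hl, Multiset.map_coe,
    Multiset.sum_coe]
  rfl

variable [Fintype X] [Fintype Y] [DecidableEq X] [DecidableEq Y]

/-- Distributions of the letters of `Y` over `X`. -/
@[ext] structure Om (X Y : Type) [Fintype X] [Fintype Y] : Type where
  /-- the distribution -/
  fn : X → List Y
  sum_eq : ∑ x, (fn x : Multiset Y) = Finset.univ.val

instance : Finite (Om X Y) := by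
  have hn : ∀ (w : Om X Y) x, (w.fn x).Nodup := by
    intro w x
    rw [← Multiset.coe_nodup]
    refine Multiset.nodup_of_le ?_ (Finset.univ : Finset Y).nodup
    rw [← w.sum_eq]
    exact Finset.single_le_sum_of_canonicallyOrdered (f := fun x => (w.fn x : Multiset Y))
      (Finset.mem_univ x)
  refine Finite.of_injective
    (fun (w : Om X Y) x => (⟨w.fn x, hn w x⟩ : {l : List Y // l.Nodup})) ?_
  intro w w' h
  refine Om.ext (funext fun x => ?_)
  exact congrArg Subtype.val (congrFun h x)

noncomputable instance : MulAction (Equiv.Perm X × Equiv.Perm Y) (Om X Y) where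
  smul g w := ⟨fun x => (w.fn (g.1⁻¹ x)).map g.2, by
    have h1 : ∑ x, (((w.fn (g.1⁻¹ x)).map g.2 : List Y) : Multiset Y) =
        Multiset.mapAddMonoidHom g.2 (∑ x, (w.fn (g.1⁻¹ x) : Multiset Y)) := by
      rw [map_sum]; rfl
    rw [h1, Equiv.sum_comp g.1⁻¹ fun x => (w.fn x : Multiset Y), w.sum_eq]
    exact Multiset.map_univ_val_equiv _⟩
  one_smul w := Om.ext (funext fun x => List.map_id _)
  mul_smul g h w := Om.ext (funext fun x => by
    change List.map _ (w.fn _) = List.map _ (List.map _ (w.fn _))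
    rw [List.map_map]
    simp [mul_inv_rev])

theorem Om_smul (g : Equiv.Perm X × Equiv.Perm Y) (w : Om X Y) (x : X) :
    (g • w).fn x = (w.fn (g.1⁻¹ x)).map g.2 := rfl

/-- The component of the elimination isomorphism. -/
noncomputable def phw (F : Type) [Field F] (w : X → List Y) : T F X →ₗ[F] T F (X ⊕ Y) :=
  ((phi F X Y).comp (tmap fun x => (x, w x))).toLinearMap

theorem phw_apply (w : X → List Y) (u : T F X) :
    phw F w u = phi F X Y (tmap (fun x => (x, w x)) u) := rfl

theorem phw_mem (w : Om X Y) (u : T F X) (hu : u ∈ LL F (Finset.univ.val : Multiset X)) :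
    phw F w.fn u ∈ LL F (Finset.univ.val : Multiset (X ⊕ Y)) := by
  suffices h : LL F (Finset.univ.val : Multiset X) ≤
    (LL F (Finset.univ.val : Multiset (X ⊕ Y))).comap (phw F w.fn) from h hu
  refine Submodule.span_le.2 ?_
  rintro v ⟨l, hl, rfl⟩
  change phw F w.fn (lw F l) ∈ LL F (Finset.univ.val : Multiset (X ⊕ Y))
  rw [phw_apply, tmap_lw]
  have : tot (l.map fun x => (x, w.fn x)) = Finset.univ.val := by
    rw [tot_eq, flatten_label l hl, w.sum_eq, List.map_map, univ_sum_val]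
    have h2 : (Prod.fst ∘ fun x => (x, w.fn x)) = (id : X → X) := rfl
    rw [h2, List.map_id, hl]
  rw [← this]
  exact phi_lw_mem _

/-- The elimination isomorphism, finsupp version. -/
noncomputable def Ph (F X Y : Type) [Field F] [Fintype X] [Fintype Y] [DecidableEq X]
    [DecidableEq Y] : (Om X Y →₀ LL F (Finset.univ.val : Multiset X)) →ₗ[F]
      LL F (Finset.univ.val : Multiset (X ⊕ Y)) :=
  Finsupp.lsum F fun w => (phw F w.fn).restrict (phw_mem w)

theorem Ph_single (w : Om X Y) (u : LL F (Finset.univ.val : Multiset X)) :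
    (Ph F X Y (Finsupp.single w u) : T F (X ⊕ Y)) = phw F w.fn u := by
  simp [Ph]

theorem kap_Ph (f : Om X Y →₀ LL F (Finset.univ.val : Multiset X)) (w : Om X Y) :
    kap F X Y (eps F X Y (Ph F X Y f)) w.fn = f w := by
  induction f using Finsupp.induction_linear with
  | zero => simp
  | add f g hf hg =>
    rw [map_add, Submodule.coe_add, map_add, map_add, Finsupp.add_apply, hf, hg]; rfl
  | single w' u =>
    rw [Ph_single, phw_apply, eps_phi, kap_tmap _ _ (LL_le_Tm _ u.2)]
    classical
    rw [Finsupp.single_apply, Finsupp.single_apply]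
    by_cases h : w' = w
    · subst h; simp
    · have : w'.fn ≠ w.fn := fun e => h (Om.ext e)
      simp [h, this]

theorem Ph_injective : Function.Injective (Ph F X Y) := by
  intro f g h
  ext w : 1
  apply Subtype.ext
  rw [← kap_Ph, h, kap_Ph]

theorem Ph_surjective [Nonempty X] : Function.Surjective (Ph F X Y) := by
  rw [← LinearMap.range_eq_top]
  suffices h : II F X Y Finset.univ.val ≤
      (LinearMap.range (Ph F X Y)).map (Submodule.subtype _) by
    rw [eq_top_iff]
    intro v _
    obtain ⟨x0⟩ := ‹Nonempty X›
    obtain ⟨v', hv', e⟩ := h (LL_le_II _ ⟨x0, Finset.mem_univ _⟩ v.2)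
    have : v' = v := Subtype.ext e
    rwa [← this]
  refine Submodule.span_le.2 ?_
  rintro v ⟨ls, hls, rfl⟩
  rw [tot_eq, univ_sum_val] at hls
  obtain ⟨h1, h2⟩ := disjSum_inj hls
  have hn : (ls.map Prod.fst).Nodup := by
    rw [← Multiset.coe_nodup, h1]; exact Finset.univ.nodup
  obtain ⟨w, hw⟩ := exists_label ls hn
  have h3 : ∑ x, (w x : Multiset Y) = Finset.univ.val := by
    rw [← flatten_label _ h1 w, ← hw, h2]
  have hm : lw F (ls.map Prod.fst) ∈ LL F (Finset.univ.val : Multiset X) := by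
    rw [← h1]; exact lw_mem_LL _
  refine ⟨Ph F X Y (Finsupp.single ⟨w, h3⟩ ⟨_, hm⟩), ⟨_, rfl⟩, ?_⟩
  rw [Submodule.subtype_apply, Ph_single, phw_apply]
  change phi F X Y (tmap _ (lw F _)) = _
  rw [tmap_lw, ← hw]

theorem phw_equi (g : Equiv.Perm X × Equiv.Perm Y) (w : Om X Y) (u : T F X) :
    phw F (g • w).fn (tmap g.1 u) = tmap (Sum.map g.1 g.2) (phw F w.fn u) := by
  have : (((phi F X Y).comp (tmap fun x => (x, (g • w).fn x))).comp (tmap g.1) :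
        T F X →ₐ[F] T F (X ⊕ Y)) =
      (tmap (Sum.map g.1 g.2)).comp ((phi F X Y).comp (tmap fun x => (x, w.fn x))) := by
    apply alg_ext
    intro x
    simp only [AlgHom.comp_apply, tmap_ltr, phi_ltr, tmap_lw, Om_smul]
    simp [exl, Function.comp_def]
  exact AlgHom.congr_fun this u

theorem ep_elim [Nonempty X] (h : EP (lieR F X)) :
    EP ((lieR F (X ⊕ Y)).comp (Equiv.Perm.sumCongrHom X Y) :
      Representation F (Equiv.Perm X × Equiv.Perm Y) _) := by
  classical
  have h1 : EP (finRep F (Equiv.Perm X × Equiv.Perm Y) (Om X Y)) := finRep_isPerm.pp.ep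
  have h2 := EP.comp_hom (MonoidHom.fst (Equiv.Perm X) (Equiv.Perm Y)) h
  have := finite_LL (F := F) (X := X)
  have h3 := EP.tprod h1 h2
  let e := TensorProduct.finsuppScalarLeft F (LL F (Finset.univ.val : Multiset X)) (Om X Y)
  have he : ∀ (w : Om X Y) (c : F) u, e (Finsupp.single w c ⊗ₜ u) = Finsupp.single w (c • u) := by
    intro w c u
    simp [e, TensorProduct.finsuppScalarLeft_apply_tmul]
  refine h3.of_bijective' (Ph F X Y ∘ₗ e.toLinearMap)
    (Function.Bijective.comp (g := Ph F X Y) ⟨Ph_injective, Ph_surjective⟩ e.bijective) ?_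
  intro g v
  induction v using TensorProduct.induction_on with
  | zero => simp
  | add x y hx hy => rw [map_add, map_add, map_add, map_add, hx, hy]
  | tmul f u =>
    induction f using Finsupp.induction_linear with
    | zero => simp
    | add x y hx hy => rw [TensorProduct.add_tmul, map_add, map_add, map_add, map_add, hx, hy]
    | single w c =>
      rw [Representation.tprod_apply, TensorProduct.map_tmul, finRep_single]
      apply Subtype.ext
      change ((Ph F X Y (e (_ ⊗ₜ _)) : LL F _) : T F (X ⊕ Y)) =
        tmap (Sum.map g.1 g.2) ((Ph F X Y (e (_ ⊗ₜ _)) : LL F _) : T F (X ⊕ Y))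
      rw [he, he, Ph_single, Ph_single, ← phw_equi]
      rw [Submodule.coe_smul, Submodule.coe_smul, map_smul, map_smul, map_smul]
      rfl

end ElimRep

end LieEP

namespace LieEP

section Transport

variable {F : Type} [Field F]

theorem EP.transport {Z Z' : Type} [Fintype Z] [DecidableEq Z] [Fintype Z'] [DecidableEq Z']
    (e : Z ≃ Z') (h : EP (lieR F Z)) : EP (lieR F Z') := by
  have h' := EP.comp_hom (e.symm.permCongrHom.toMonoidHom : Equiv.Perm Z' →* Equiv.Perm Z) h
  refine h'.of_bijective'
    ((tmap e : T F Z →ₐ[F] T F Z').toLinearMap.restrict fun v hv => tmap_LL_univ e v hv) ⟨?_, ?_⟩ ?_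
  · intro v w hvw
    apply Subtype.ext
    have h1 : tmap e (v : T F Z) = tmap e (w : T F Z) := congrArg Subtype.val hvw
    have h2 := congrArg (tmap e.symm) h1
    have h3 : (e.symm : Z' → Z) ∘ e = id := by ext x; simp
    rwa [tmap_tmap, tmap_tmap, h3, tmap_id, tmap_id] at h2
  · intro v
    refine ⟨⟨tmap e.symm (v : T F Z'), tmap_LL_univ e.symm _ v.2⟩, ?_⟩
    apply Subtype.ext
    change tmap e (tmap e.symm (v : T F Z')) = v
    have h3 : (e : Z → Z') ∘ e.symm = id := by ext x; simp
    rw [tmap_tmap, h3, tmap_id]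
  · intro g v
    apply Subtype.ext
    change tmap e (tmap _ (v : T F Z)) = tmap g (tmap e (v : T F Z))
    rw [tmap_tmap, tmap_tmap]
    congr 2
    ext x
    simp [Equiv.permCongrHom]

theorem index_ne_zero (p : ℕ) [hp : Fact p.Prime] [CharP F p] (k m : ℕ) (hk : ¬ p ∣ k)
    (hm : p * k = p + m) :
    ((Nat.card (Equiv.Perm (Fin p ⊕ Fin m) ⧸
      (Equiv.Perm.sumCongrHom (Fin p) (Fin m)).range) : ℕ) : F) ≠ 0 := by
  have h1 := Subgroup.card_eq_card_quotient_mul_card_subgroup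
    (Equiv.Perm.sumCongrHom (Fin p) (Fin m)).range
  have h2 : Nat.card (Equiv.Perm.sumCongrHom (Fin p) (Fin m)).range =
      p.factorial * m.factorial := by
    rw [← Nat.card_congr
      (MonoidHom.ofInjective (Equiv.Perm.sumCongrHom_injective (α := Fin p) (β := Fin m))).toEquiv]
    simp [Nat.card_prod, Fintype.card_perm]
  have h3 : Nat.card (Equiv.Perm (Fin p ⊕ Fin m)) = (p + m).factorial := by
    simp [Fintype.card_perm]
  rw [h2, h3, ← Nat.add_choose_mul_factorial_mul_factorial, mul_assoc] at h1
  have h4 := Nat.eq_of_mul_eq_mul_right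
    (Nat.mul_pos (Nat.factorial_pos p) (Nat.factorial_pos m)) h1
  rw [← h4, Ne, CharP.cast_eq_zero_iff F p, ← Nat.choose_symm_add, ← hm]
  have h5 := Choose.choose_modEq_choose_mod_mul_choose_div_nat (n := p * k) (k := p) (p := p)
  rw [Nat.mul_mod_right, Nat.mod_self, Nat.mul_div_cancel_left _ hp.out.pos,
    Nat.div_self hp.out.pos, Nat.choose_zero_right, Nat.choose_one_right, one_mul] at h5
  rwa [h5.dvd_iff dvd_rfl]

theorem ep_lie_fin (p : ℕ) [hp : Fact p.Prime] [CharP F p] (k : ℕ) (hk : ¬ p ∣ k) :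
    EP (lieR F (Fin (p * k))) := by
  have hk0 : 0 < k := Nat.pos_of_ne_zero fun h => hk (h ▸ dvd_zero p)
  obtain ⟨m, hm⟩ : ∃ m, p * k = p + m := ⟨p * k - p, by
    have : p * 1 ≤ p * k := Nat.mul_le_mul_left p hk0
    omega⟩
  have : Nonempty (Fin p) := ⟨⟨0, hp.out.pos⟩⟩
  have h1 : EP (lieR F (Fin p)) := ep_lieR p (by simp)
  have h2 := ep_elim (Y := Fin m) h1
  have h3 := EP.of_hom _ (index_ne_zero p k m hk hm) h2
  exact h3.transport (finSumFinEquiv.trans (finCongr hm.symm))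

end Transport

section Bridge

variable {F : Type} [Field F]

/-- The group algebra inside the tensor algebra. -/
noncomputable def emb (F : Type) [Field F] (n : ℕ) :
    MonoidAlgebra F (Equiv.Perm (Fin n)) →ₗ[F] T F (Fin n) where
  toFun := MonoidAlgebra.mapDomain fun s => FreeMonoid.ofList (List.ofFn s)
  map_add' := MonoidAlgebra.mapDomain_add _
  map_smul' c x := by
    ext; simp [Finsupp.mapDomain_smul]

theorem emb_single {n : ℕ} (s : Equiv.Perm (Fin n)) :
    emb F n (MonoidAlgebra.single s 1) = wd F (List.ofFn s) :=
  MonoidAlgebra.mapDomain_single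

theorem emb_injective (n : ℕ) : Function.Injective (emb F n) := by
  refine MonoidAlgebra.mapDomain_injective ?_
  intro s t h
  have h' : List.ofFn s = List.ofFn t := h
  exact DFunLike.coe_injective (List.ofFn_injective h')

theorem ga_ext {n : ℕ} {B : Type} [AddCommGroup B] [Module F B]
    {f g : MonoidAlgebra F (Equiv.Perm (Fin n)) →ₗ[F] B}
    (h : ∀ s, f (MonoidAlgebra.single s 1) = g (MonoidAlgebra.single s 1)) : f = g := by
  refine LinearMap.ext fun v => ?_
  induction v using MonoidAlgebra.induction_linear with
  | zero => simp
  | add x y hx hy => simp [hx, hy]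
  | single w c =>
    have : MonoidAlgebra.single w c = c • MonoidAlgebra.single w (1 : F) := by simp
    rw [this, map_smul, map_smul, h]

theorem emb_left {n : ℕ} (s : Equiv.Perm (Fin n)) (x : MonoidAlgebra F (Equiv.Perm (Fin n))) :
    emb F n (MonoidAlgebra.single s 1 * x) = tmap s (emb F n x) := by
  have : emb F n ∘ₗ LinearMap.mulLeft F (MonoidAlgebra.single s (1 : F)) =
      (tmap s : T F (Fin n) →ₐ[F] T F (Fin n)).toLinearMap ∘ₗ emb F n := by
    refine ga_ext fun t => ?_
    change emb F n (MonoidAlgebra.single s 1 * MonoidAlgebra.single t 1) =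
      tmap s (emb F n (MonoidAlgebra.single t 1))
    rw [MonoidAlgebra.single_mul_single, one_mul, emb_single, emb_single, tmap_wd, List.map_ofFn]
    rfl
  exact LinearMap.congr_fun this x

/-- Moving a letter to the front. -/
noncomputable def front (F : Type) [Field F] {α : Type} (j : ℕ) : T F α →ₗ[F] T F α :=
  wlift fun l => wd F ((l.drop j).take 1 ++ l.take j ++ l.drop (j + 1))

theorem ofFn_cycle {n : ℕ} (i : Fin n) (t : Equiv.Perm (Fin n)) :
    List.ofFn (t * (Fin.cycleRange i)⁻¹ : Equiv.Perm (Fin n)) =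
      ((List.ofFn t).drop i).take 1 ++ (List.ofFn t).take i ++ (List.ofFn t).drop (i + 1) := by
  cases n with
  | zero => exact i.elim0
  | succ n =>
    have hi : (i : ℕ) < n + 1 := i.2
    have h1 : ((List.ofFn t).drop i).take 1 = [t i] := by
      rw [List.drop_eq_getElem_cons (by rw [List.length_ofFn]; exact hi), List.take_succ_cons,
        List.take_zero, List.getElem_ofFn]
    rw [h1, List.ofFn_succ]
    simp only [List.singleton_append, List.cons_append]
    congr 1
    · change t (i.cycleRange.symm 0) = t i
      rw [Fin.cycleRange_symm_zero]
    · refine List.ext_getElem (by simp; omega) ?_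
      intro k hk1 hk2
      have hk : k < n := by simpa using hk1
      have e : (t * (Fin.cycleRange i)⁻¹ : Equiv.Perm (Fin (n + 1))) (Fin.succ ⟨k, hk⟩) =
        t (i.succAbove ⟨k, hk⟩) := by
        change t (i.cycleRange.symm _) = _
        rw [Fin.cycleRange_symm_succ]
      rw [List.getElem_ofFn, e, List.getElem_append]
      by_cases hki : k < i
      · rw [dif_pos (by simp; omega)]
        rw [Fin.succAbove_of_castSucc_lt _ _ (by simpa [Fin.lt_def] using hki)]
        simp only [List.nil_append, List.getElem_take, List.getElem_ofFn]
        rfl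
      · rw [dif_neg (by simp; omega)]
        rw [Fin.succAbove_of_le_castSucc _ _ (by simpa [Fin.le_def] using hki)]
        simp only [List.getElem_drop, List.getElem_ofFn, List.length_take, List.length_ofFn]
        congr 1
        apply Fin.ext
        simp
        omega

theorem emb_right {n : ℕ} (i : Fin n) (x : MonoidAlgebra F (Equiv.Perm (Fin n))) :
    emb F n (x * MonoidAlgebra.of F (Equiv.Perm (Fin n)) (Fin.cycleRange i)⁻¹) =
      front F i (emb F n x) := by
  have : emb F n ∘ₗ LinearMap.mulRight F
      (MonoidAlgebra.of F (Equiv.Perm (Fin n)) (Fin.cycleRange i)⁻¹) =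
      front F i ∘ₗ emb F n := by
    refine ga_ext fun t => ?_
    change emb F n (MonoidAlgebra.single t 1 * MonoidAlgebra.single _ 1) =
      front F i (emb F n (MonoidAlgebra.single t 1))
    rw [MonoidAlgebra.single_mul_single, one_mul, emb_single, emb_single, front, wlift_wd,
      ofFn_cycle]
  exact LinearMap.congr_fun this x

theorem front_mul {α : Type} (S : Multiset α) (v : T F α) (hv : v ∈ Tm F S) (z : α) (r : List α) :
    front F (Multiset.card S) (v * (ltr F z * wd F r)) = ltr F z * (v * wd F r) := by
  induction hv using Submodule.span_induction with
  | mem x hx =>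
    obtain ⟨l, rfl, rfl⟩ := hx
    rw [← wd_cons, ← wd_append, ← wd_append, ← wd_cons, front, wlift_wd, Multiset.coe_card]
    congr 1
    have h1 : (l ++ z :: r).drop l.length = z :: r := by simp
    have h2 : (l ++ z :: r).take l.length = l := by simp
    have h3 : (l ++ z :: r).drop (l.length + 1) = r := by
      rw [← List.drop_drop, h1]; simp
    rw [h1, h2, h3]; simp
  | zero => simp
  | add x y _ _ hx hy => simp only [add_mul, mul_add, map_add, hx, hy]
  | smul c x _ hx =>
    rw [smul_mul_assoc, map_smul, hx, smul_mul_assoc, mul_smul_comm]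

theorem emb_dsw_partial {n : ℕ} (hn : 0 < n) (s : Equiv.Perm (Fin n)) (j : ℕ) (hj : j + 1 ≤ n) :
    emb F n (MonoidAlgebra.single s 1 * ((List.range j).map fun i =>
      (1 : MonoidAlgebra F (Equiv.Perm (Fin n))) -
        MonoidAlgebra.of F (Equiv.Perm (Fin n))
          (Fin.cycleRange ⟨(i + 1) % n, Nat.mod_lt _ hn⟩)⁻¹).prod) =
      lw F ((List.ofFn s).take (j + 1)) * wd F ((List.ofFn s).drop (j + 1)) := by
  induction j with
  | zero =>
    simp only [List.range_zero, List.map_nil, List.prod_nil, mul_one, emb_single]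
    have h1 : (List.ofFn s).take (0 + 1) = [s ⟨0, hn⟩] := by
      have := List.drop_eq_getElem_cons (l := List.ofFn s) (i := 0) (by simpa using hn)
      rw [List.drop_zero] at this
      rw [this]; simp
    rw [h1, lw_singleton, ltr, ← wd_append, ← h1, List.take_append_drop]
  | succ j ih =>
    have ih := ih (by omega)
    have hjn : j + 1 < n := by omega
    rw [List.range_succ, List.map_append, List.prod_append, List.map_singleton,
      List.prod_singleton, ← mul_assoc, mul_sub, mul_one, map_sub, emb_right, ih]
    have hl : (List.ofFn s).drop (j + 1) =
        s ⟨j + 1, hjn⟩ :: (List.ofFn s).drop (j + 1 + 1) := by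
      rw [List.drop_eq_getElem_cons (by simpa using hjn)]; simp
    have ht : (List.ofFn s).take (j + 1 + 1) =
        (List.ofFn s).take (j + 1) ++ [s ⟨j + 1, hjn⟩] := by
      rw [List.take_succ_eq_append_getElem (by simpa using hjn)]; simp
    have hlen : ((List.ofFn s).take (j + 1)).length = j + 1 := by
      simp; omega
    have hne : (List.ofFn s).take (j + 1) ≠ [] := by
      intro h; rw [h] at hlen; simp at hlen
    have hmod : (j + 1) % n = j + 1 := Nat.mod_eq_of_lt hjn
    have hf := front_mul (F := F) _ _ (lw_mem_Tm ((List.ofFn s).take (j + 1))) (s ⟨j + 1, hjn⟩)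
      ((List.ofFn s).drop (j + 1 + 1))
    rw [Multiset.coe_card, hlen] at hf
    simp only [hmod]
    rw [hl, wd_cons, hf, ht, lw_concat _ hne, Ring.lie_def, sub_mul, mul_assoc, mul_assoc]

theorem emb_dsw {n : ℕ} (hn : 0 < n) (s : Equiv.Perm (Fin n)) :
    emb F n (MonoidAlgebra.single s 1 * dswElement F n hn) = lw F (List.ofFn s) := by
  have := emb_dsw_partial (F := F) hn s (n - 1) (by omega)
  rw [dswElement, this]
  have e : n - 1 + 1 = n := by omega
  have h1 : (List.ofFn s).take (n - 1 + 1) = List.ofFn s := by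
    rw [e, List.take_of_length_le]; simp
  have h2 : (List.ofFn s).drop (n - 1 + 1) = [] := by
    rw [e, List.drop_of_length_le]; simp
  rw [h1, h2, wd_nil, mul_one]

theorem ofFn_perm {n : ℕ} (s : Equiv.Perm (Fin n)) :
    ((List.ofFn s : List (Fin n)) : Multiset (Fin n)) = Finset.univ.val := by
  have h : List.ofFn s = (List.ofFn (id : Fin n → Fin n)).map s := by
    rw [List.map_ofFn]; rfl
  rw [h, ← Multiset.map_coe]
  have h2 : ((List.ofFn (id : Fin n → Fin n) : List (Fin n)) : Multiset (Fin n)) =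
      Finset.univ.val := by
    rw [Fin.univ_val_map (f := (id : Fin n → Fin n)) |>.symm, Multiset.map_id]
  rw [h2, Multiset.map_univ_val_equiv]

theorem emb_mem {n : ℕ} (hn : 0 < n) (x : MonoidAlgebra F (Equiv.Perm (Fin n)))
    (hx : x ∈ lieModule F n hn) :
    emb F n x ∈ LL F (Finset.univ.val : Multiset (Fin n)) := by
  obtain ⟨y, rfl⟩ := Submodule.mem_span_singleton.1 hx
  rw [smul_eq_mul]
  clear hx
  induction y using MonoidAlgebra.induction_linear with
  | zero => simp
  | add x y hx hy => rw [add_mul, map_add]; exact Submodule.add_mem _ hx hy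
  | single s c =>
    have : MonoidAlgebra.single s c = c • MonoidAlgebra.single s (1 : F) := by simp
    rw [this, smul_mul_assoc, map_smul, emb_dsw, ← ofFn_perm s]
    exact Submodule.smul_mem _ _ (lw_mem_LL _)

/-- The comparison map. -/
noncomputable def brg (F : Type) [Field F] (n : ℕ) (hn : 0 < n) :
    lieModule F n hn →ₗ[F] LL F (Finset.univ.val : Multiset (Fin n)) :=
  LinearMap.codRestrict (LL F (Finset.univ.val : Multiset (Fin n)))
    (emb F n ∘ₗ ((lieModule F n hn).subtype.restrictScalars F))
    fun x => emb_mem (F := F) hn (x : MonoidAlgebra F (Equiv.Perm (Fin n))) x.2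

theorem brg_apply {n : ℕ} (hn : 0 < n) (x : lieModule F n hn) :
    (brg F n hn x : T F (Fin n)) = emb F n x := rfl

theorem brg_bijective {n : ℕ} (hn : 0 < n) : Function.Bijective (brg F n hn) := by
  constructor
  · intro x y h
    apply Subtype.ext
    apply emb_injective n
    rw [← brg_apply, h, brg_apply]
  · rw [← LinearMap.range_eq_top]
    suffices h : LL F (Finset.univ.val : Multiset (Fin n)) ≤
        (LinearMap.range (brg F n hn)).map (Submodule.subtype _) by
      rw [eq_top_iff]
      intro v _
      obtain ⟨v', hv', e⟩ := h v.2
      have : v' = v := Subtype.ext e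
      rwa [← this]
    refine Submodule.span_le.2 ?_
    rintro v ⟨l, hl, rfl⟩
    obtain ⟨g, hg⟩ := exists_perm hl (ofFn_perm (1 : Equiv.Perm (Fin n)))
    rw [List.map_ofFn] at hg
    have hm : MonoidAlgebra.single g (1 : F) * dswElement F n hn ∈ lieModule F n hn :=
      Submodule.mem_span_singleton.2 ⟨_, rfl⟩
    refine ⟨brg F n hn ⟨_, hm⟩, ⟨_, rfl⟩, ?_⟩
    rw [Submodule.subtype_apply, brg_apply]
    change emb F n (_ * _) = _
    rw [emb_dsw, ← hg]
    rfl

theorem ep_lieRep {n : ℕ} (hn : 0 < n) (h : EP (lieR F (Fin n))) : EP (lieRep F n hn) := by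
  refine h.of_bijective (brg F n hn) (brg_bijective hn) ?_
  intro g v
  apply Subtype.ext
  rw [brg_apply, lieR_apply, brg_apply, ← emb_left]
  have := mrep_apply (F := F) g v
  exact congrArg (fun w : lieModule F n hn => emb F n w) this

end Bridge

end LieEP

/-- Let `G` be a finite group over `F` of characteristic `p`, and `M` a
nonzero `FG`-module such that `Ω⁻¹(M)` is a `p`-permutation module.  Then
`M ≅ Ω(Ω⁻¹(M)) ⊕ Q` for some projective `FG`-module `Q`, and `M` is an
endo-`p`-permutation module (i.e. `M ⊗ M*` is a `p`-permutation module); in particular the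
Lie module `Lie(pk)` (`p ∤ k`) is an endo-`p`-permutation `F𝔖_{pk}`-module. -/
theorem endo_p_permutation_of_heller_inverse_p_permutation
    (F : Type) [Field F] [IsAlgClosed F] (p : ℕ) [hp : Fact p.Prime] [CharP F p]
    (G : Type) [Group G] [Finite G]
    (V : Type) [AddCommGroup V] [Module F V] (ρ : Representation F G V) (hV : Nontrivial V)
    (L : ModuleCat.{0} (MonoidAlgebra F G))
    (hL : isOmegaZPow (-1) (ModuleCat.of (MonoidAlgebra F G) ρ.asModule) L)
    (hLperm : isPPermutationModule F G ↥L)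
    (k : ℕ) (hk : 0 < k) (hpk : ¬ p ∣ k) :
    ((∃ K Q : ModuleCat.{0} (MonoidAlgebra F G), isSyzygy L K ∧
        Module.Projective (MonoidAlgebra F G) Q ∧
        Nonempty (ρ.asModule ≃ₗ[MonoidAlgebra F G] (↥K × ↥Q))) ∧
      isPPermutationModule F G (ρ.tprod ρ.dual).asModule) ∧
    isPPermutationModule F (Equiv.Perm (Fin (p * k)))
      (((lieRep F (p * k) (Nat.mul_pos hp.out.pos hk)).tprod
        (lieRep F (p * k) (Nat.mul_pos hp.out.pos hk)).dual).asModule) := by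
  exact ⟨LieEP.part_one F G V ρ L hL hLperm,
    LieEP.isPP_tprod_dual (LieEP.ep_lieRep _ (LieEP.ep_lie_fin p k hpk))⟩
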